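/- arXiv:1711.05022 — 2 statements merged into one kernel-verified Lean document; each statement's English description precedes it below -/
import Mathlib

section
/- Suppose along a sequence α → λ₁⁻ the functions v_α are smooth positive solutions of Δv_α = v_α(A_α + Λ_α exp(v_α²)) in Ω with v_α = 0 on ∂Ω, A_α ∈ [0, λ₁), Λ_α > 0, ∫_Ω |∇v_α|² dy → 4π, A_α → λ₁, ∫_Ω v_α² dy → 0, and ∫_Ω exp(v_α²) dy → +∞. Then Λ_α → 0 as α → λ₁⁻. (Key ingredients: Λ_α ∫_Ω v_α² exp(v_α²) dy = ∫_Ω |∇v_α|² dy − A_α ∫_Ω v_α² dy = 4π + o(1), together with the elementary inequality e^t ≤ 1 + t e^t for t ≥ 0.) -/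
open MeasureTheory intervalIntegral Real Filter Topology Metric Bornology RealInnerProductSpace

noncomputable section

/-- The Euclidean plane `ℝ²`. -/
abbrev E2 : Type := EuclideanSpace ℝ (Fin 2)

/-- The Laplacian with the paper's sign convention `Δ = −(∂²/∂x² + ∂²/∂y²)`. -/
def lapl (u : E2 → ℝ) (x : E2) : ℝ :=
  -(∑ i : Fin 2, iteratedFDeriv ℝ 2 u x ![EuclideanSpace.single i 1, EuclideanSpace.single i 1])

/-- A `C¹` cutoff vanishing on `(-∞, ε]`, with derivative at most `1` and bounded below by
`t - 2 * ε`. -/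
theorem exists_cutoff {ε : ℝ} (hε : 0 < ε) :
    ∃ χ χ' : ℝ → ℝ, Continuous χ' ∧ (∀ t, HasDerivAt χ (χ' t) t) ∧ (∀ t, χ' t ≤ 1) ∧
      (∀ t ≤ ε, χ t = 0) ∧ ∀ t, t - 2 * ε ≤ χ t := by
  have hc : Continuous fun s : ℝ => max 0 (min 1 (s / ε - 1)) := by fun_prop
  have hint (a b : ℝ) : IntervalIntegrable (fun s : ℝ => max 0 (min 1 (s / ε - 1))) volume a b :=
    hc.intervalIntegrable a b
  have hzero (s : ℝ) (hs : s ≤ ε) : max 0 (min 1 (s / ε - 1)) = 0 :=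
    max_eq_left ((min_le_right _ _).trans (sub_nonpos.2 ((div_le_one hε).2 hs)))
  have hone (s : ℝ) (hs : 2 * ε ≤ s) : max 0 (min 1 (s / ε - 1)) = 1 := by
    have : 2 ≤ s / ε := (le_div_iff₀ hε).2 hs
    rw [min_eq_left (by linarith), max_eq_right zero_le_one]
  have hχ0 (t : ℝ) (ht : t ≤ ε) : ∫ s in ε..t, max 0 (min 1 (s / ε - 1)) = 0 := by
    rw [integral_congr (g := fun _ => (0 : ℝ)), intervalIntegral.integral_zero]
    intro s hs
    rw [Set.uIcc_of_ge ht] at hs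
    exact hzero s hs.2
  have hχnn (t : ℝ) : 0 ≤ ∫ s in ε..t, max 0 (min 1 (s / ε - 1)) := by
    rcases le_total t ε with ht | ht
    · exact (hχ0 t ht).ge
    · exact intervalIntegral.integral_nonneg ht fun s _ => le_max_left _ _
  refine ⟨fun t => ∫ s in ε..t, max 0 (min 1 (s / ε - 1)), _, hc,
    fun t => hc.integral_hasStrictDerivAt ε t |>.hasDerivAt,
    fun t => max_le zero_le_one (min_le_left _ _), hχ0, fun t => ?_⟩
  rcases le_total t (2 * ε) with ht | ht
  · exact (sub_nonpos.2 ht).trans (hχnn t)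
  · have h : ∫ s in (2 * ε)..t, max 0 (min 1 (s / ε - 1)) = t - 2 * ε := by
      rw [integral_congr (g := fun _ => (1 : ℝ)), integral_one]
      intro s hs
      rw [Set.uIcc_of_le ht] at hs
      exact hone s hs.1
    have := integral_add_adjacent_intervals (hint ε (2 * ε)) (hint (2 * ε) t)
    have := hχnn (2 * ε)
    dsimp only
    linarith

/-- An integrable directional derivative of an integrable function has integral zero. -/
theorem integral_hasLineDerivAt_eq_zero {f f' : E2 → ℝ} {e : E2} (hf : Integrable f)
    (hf' : Integrable f') (h : ∀ x, HasLineDerivAt ℝ f (f' x) x e) : ∫ x, f' x = 0 := by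
  have := integral_bilinear_hasLineDerivAt_right_eq_neg_left_of_integrable (μ := volume)
    (f := f) (f' := f') (g := fun _ => (1 : ℝ)) (g' := fun _ => 0) (v := e)
    (B := ContinuousLinearMap.mul ℝ ℝ) (by simpa using hf') (by simp) (by simpa using hf)
    (fun x _ => h x)
    (fun x _ => by simpa [HasLineDerivAt] using hasDerivAt_const (0 : ℝ) (1 : ℝ))
  simpa using this

/-- The integral over an open set of a directional derivative of a `C¹` function supported in a
compact subset vanishes. -/
theorem setIntegral_fderiv_apply_eq_zero {Ω K : Set E2} (hΩ : IsOpen Ω) (hK : IsCompact K)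
    (hKΩ : K ⊆ Ω) {g : E2 → ℝ} {G : E2 → E2 →L[ℝ] ℝ} {e : E2}
    (hg : ∀ y ∈ Ω, HasFDerivAt g (G y) y) (hG : ContinuousOn (fun y => G y e) Ω)
    (hg0 : ∀ y ∈ Ω, y ∉ K → g y = 0) : IntegrableOn (fun y => G y e) Ω ∧ ∫ y in Ω, G y e = 0 := by
  have hG0 : ∀ y ∈ Ω, y ∉ K → G y = 0 := fun y hy hyK => by
    refine (hg y hy).unique ((hasFDerivAt_const (0 : ℝ) y).congr_of_eventuallyEq ?_)
    filter_upwards [hΩ.mem_nhds hy, hK.isClosed.isOpen_compl.mem_nhds hyK] with z hz hzK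
    exact hg0 z hz hzK
  have hcont {F : E2 → ℝ} (hF : ContinuousOn F Ω) (hF0 : ∀ y ∈ Ω, y ∉ K → F y = 0) :
      Integrable (Ω.indicator F) := by
    have hz : ∀ y, y ∉ K → Ω.indicator F y = 0 := fun y hyK => by
      by_cases hy : y ∈ Ω
      · rw [Set.indicator_of_mem hy, hF0 y hy hyK]
      · exact Set.indicator_of_notMem hy F
    refine Continuous.integrable_of_hasCompactSupport (continuous_iff_continuousAt.2 fun y => ?_)
      (HasCompactSupport.intro hK hz)
    by_cases hy : y ∈ Ω
    · refine (hF.continuousAt (hΩ.mem_nhds hy)).congr ?_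
      filter_upwards [hΩ.mem_nhds hy] with z hz
      exact (Set.indicator_of_mem hz F).symm
    · refine (continuousAt_const (y := (0 : ℝ))).congr ?_
      filter_upwards [hK.isClosed.isOpen_compl.mem_nhds fun h => hy (hKΩ h)] with z hzK
      exact (hz z hzK).symm
  have hGi := hcont hG fun y hy hyK => by simp [hG0 y hy hyK]
  refine ⟨(integrable_indicator_iff hΩ.measurableSet).1 hGi, ?_⟩
  rw [← MeasureTheory.integral_indicator hΩ.measurableSet]
  refine integral_hasLineDerivAt_eq_zero (e := e)
    (hcont (fun y hy => (hg y hy).continuousAt.continuousWithinAt) hg0) hGi fun y => ?_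
  by_cases hy : y ∈ Ω
  · rw [Set.indicator_of_mem hy]
    refine ((hg y hy).congr_of_eventuallyEq ?_).hasLineDerivAt e
    filter_upwards [hΩ.mem_nhds hy] with z hz
    exact Set.indicator_of_mem hz g
  · rw [Set.indicator_of_notMem hy]
    refine HasFDerivAt.hasLineDerivAt (L := (0 : E2 →L[ℝ] ℝ))
      ((hasFDerivAt_const (0 : ℝ) y).congr_of_eventuallyEq ?_) e
    filter_upwards [hK.isClosed.isOpen_compl.mem_nhds fun h => hy (hKΩ h)] with z hzK
    by_cases hz : z ∈ Ω
    · rw [Set.indicator_of_mem hz, hg0 z hz hzK]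
    · exact Set.indicator_of_notMem hz g

theorem norm_gradient_sq (u : E2 → ℝ) (y : E2) :
    ‖gradient u y‖ ^ 2 = ∑ i : Fin 2, fderiv ℝ u y (EuclideanSpace.single i 1) ^ 2 := by
  rw [EuclideanSpace.real_norm_sq_eq]
  refine Finset.sum_congr rfl fun i _ => ?_
  congr 1
  have := InnerProductSpace.toDual_symm_apply (𝕜 := ℝ) (x := EuclideanSpace.single i (1 : ℝ))
    (y := fderiv ℝ u y)
  rw [← this, EuclideanSpace.inner_single_right]
  simp [gradient]

/-- Green's formula tested against `χ ∘ u`, for a cutoff `χ` vanishing on `(-∞, ε]`. -/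
theorem setIntegral_cutoff_mul_lapl {Ω : Set E2} (hΩo : IsOpen Ω) (hΩb : IsBounded Ω) {u : E2 → ℝ}
    (hsm : ContDiffOn ℝ (⊤ : ℕ∞) u Ω) (hct : ContinuousOn u (closure Ω))
    (hbd : ∀ y ∈ frontier Ω, u y = 0) {ε : ℝ} (hε : 0 < ε) {χ χ' : ℝ → ℝ} (hχ' : Continuous χ')
    (hχ : ∀ t, HasDerivAt χ (χ' t) t) (hχ0 : ∀ t ≤ ε, χ t = 0) :
    IntegrableOn (fun y => χ' (u y) * ‖gradient u y‖ ^ 2 - χ (u y) * lapl u y) Ω ∧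
      ∫ y in Ω, (χ' (u y) * ‖gradient u y‖ ^ 2 - χ (u y) * lapl u y) = 0 := by
  have hKc : IsCompact (closure Ω ∩ u ⁻¹' Set.Ici ε) :=
    (hΩb.isCompact_closure).of_isClosed_subset
      (hct.preimage_isClosed_of_isClosed isClosed_closure isClosed_Ici) Set.inter_subset_left
  have hKΩ : closure Ω ∩ u ⁻¹' Set.Ici ε ⊆ Ω := fun y hy => by
    by_contra hyΩ
    have h0 := hbd y (by rw [hΩo.frontier_eq]; exact ⟨hy.1, hyΩ⟩)
    have h1 : ε ≤ u y := hy.2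
    linarith
  have hχc : Continuous χ := continuous_iff_continuousAt.2 fun t => (hχ t).continuousAt
  have hd1 : ContDiffOn ℝ 1 (fderiv ℝ u) Ω := hsm.fderiv_of_isOpen hΩo (by norm_cast)
  have hd2 : ContinuousOn (fderiv ℝ (fderiv ℝ u)) Ω := hd1.continuousOn_fderiv_of_isOpen hΩo le_rfl
  have huc : ContinuousOn u Ω := hsm.continuousOn
  have key (i : Fin 2) := setIntegral_fderiv_apply_eq_zero hΩo hKc hKΩ
    (g := fun y => χ (u y) * fderiv ℝ u y (EuclideanSpace.single i 1))
    (G := fun y => χ (u y) • (fderiv ℝ (fderiv ℝ u) y).flip (EuclideanSpace.single i 1) +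
      fderiv ℝ u y (EuclideanSpace.single i 1) • χ' (u y) • fderiv ℝ u y)
    (e := EuclideanSpace.single i 1)
    (fun y hy => by
      have hu : HasFDerivAt u (fderiv ℝ u y) y :=
        ((hsm.contDiffAt (hΩo.mem_nhds hy)).differentiableAt (by simp)).hasFDerivAt
      have hdu : HasFDerivAt (fderiv ℝ u) (fderiv ℝ (fderiv ℝ u) y) y :=
        ((hd1.contDiffAt (hΩo.mem_nhds hy)).differentiableAt (by simp)).hasFDerivAt
      have := ((hχ (u y)).comp_hasFDerivAt y hu).mul
        (hdu.clm_apply (hasFDerivAt_const (EuclideanSpace.single i (1 : ℝ)) y))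
      exact this.congr_fderiv (by simp))
    (by
      have h1 : ContinuousOn (fderiv ℝ u) Ω := hd1.continuousOn
      simp only [add_apply, smul_apply, smul_eq_mul,
        ContinuousLinearMap.flip_apply]
      have h2 := hχc.comp_continuousOn huc
      have h3 := hχ'.comp_continuousOn huc
      have h4 := h1.clm_apply (continuousOn_const (c := EuclideanSpace.single i (1 : ℝ)))
      have h5 := (hd2.clm_apply (continuousOn_const (c := EuclideanSpace.single i (1 : ℝ)))).clm_apply
        (continuousOn_const (c := EuclideanSpace.single i (1 : ℝ)))
      exact (h2.mul h5).add (h4.mul (h3.mul h4)))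
    (fun y hy hyK => by
      have : u y < ε := by
        by_contra! h
        exact hyK ⟨subset_closure hy, h⟩
      simp [hχ0 _ this.le])
  have heq (y : E2) : χ' (u y) * ‖gradient u y‖ ^ 2 - χ (u y) * lapl u y =
      ∑ i : Fin 2, (χ (u y) • (fderiv ℝ (fderiv ℝ u) y).flip (EuclideanSpace.single i 1) +
      fderiv ℝ u y (EuclideanSpace.single i 1) • χ' (u y) • fderiv ℝ u y)
      (EuclideanSpace.single i 1) := by
    rw [norm_gradient_sq, lapl]
    simp [iteratedFDeriv_two_apply]
    ring
  simp_rw [heq]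
  refine ⟨integrable_finsetSum _ fun i _ => (key i).1, ?_⟩
  rw [integral_finsetSum _ fun i _ => (key i).1]
  exact Finset.sum_eq_zero fun i _ => (key i).2

/-- One half of Green's identity for nonnegative functions vanishing on the boundary, without any
regularity of the boundary. -/
theorem setIntegral_mul_lapl_le {Ω : Set E2} (hΩo : IsOpen Ω) (hΩb : IsBounded Ω) {u f : E2 → ℝ}
    (hsm : ContDiffOn ℝ (⊤ : ℕ∞) u Ω) (hct : ContinuousOn u (closure Ω))
    (hbd : ∀ y ∈ frontier Ω, u y = 0) (hf : ContinuousOn f (closure Ω))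
    (hf0 : ∀ y ∈ Ω, 0 ≤ f y) (hpde : ∀ y ∈ Ω, lapl u y = f y)
    (hgint : IntegrableOn (fun y => ‖gradient u y‖ ^ 2) Ω) :
    ∫ y in Ω, u y * f y ≤ ∫ y in Ω, ‖gradient u y‖ ^ 2 := by
  have hint {g : E2 → ℝ} (hg : ContinuousOn g (closure Ω)) : IntegrableOn g Ω :=
    (hg.integrableOn_compact hΩb.isCompact_closure).mono_set subset_closure
  have hbound : ∀ ε > 0,
      ∫ y in Ω, u y * f y ≤ (∫ y in Ω, ‖gradient u y‖ ^ 2) + ε * (2 * ∫ y in Ω, f y) := by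
    intro ε hε
    obtain ⟨χ, χ', hχ', hχ, hχ1, hχ0, hχid⟩ := exists_cutoff hε
    obtain ⟨hi, h0⟩ := setIntegral_cutoff_mul_lapl hΩo hΩb hsm hct hbd hε hχ' hχ hχ0
    have hle := setIntegral_mono_on hi
      ((hgint.sub (hint (hct.mul hf))).add ((hint hf).const_mul (2 * ε))) hΩo.measurableSet
      fun y hy => by
        have h1 := mul_le_mul_of_nonneg_right (hχ1 (u y)) (sq_nonneg ‖gradient u y‖)
        have h2 := mul_le_mul_of_nonneg_right (hχid (u y)) (hf0 y hy)
        show _ ≤ ‖gradient u y‖ ^ 2 - u y * f y + 2 * ε * f y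
        rw [hpde y hy]
        linarith
    rw [h0, integral_add' (hgint.sub (hint (hct.mul hf))) ((hint hf).const_mul (2 * ε)),
      integral_sub' hgint (hint (hct.mul hf)), MeasureTheory.integral_const_mul] at hle
    simp only [Pi.mul_apply] at hle
    linarith
  have hlim : Tendsto (fun ε : ℝ => (∫ y in Ω, ‖gradient u y‖ ^ 2) + ε * (2 * ∫ y in Ω, f y))
      (𝓝[>] 0) (𝓝 (∫ y in Ω, ‖gradient u y‖ ^ 2)) := by
    have : Continuous fun ε : ℝ => (∫ y in Ω, ‖gradient u y‖ ^ 2) + ε * (2 * ∫ y in Ω, f y) := by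
      fun_prop
    simpa using (this.tendsto 0).mono_left nhdsWithin_le_nhds
  exact ge_of_tendsto hlim (eventually_mem_nhdsWithin.mono hbound)

/-- If smooth positive solutions of `Δv = v(A + Λ e^{v²})` with zero boundary values satisfy
`∫|∇v|² → 4π`, `A → λ₁⁻`, `∫v² → 0` and `∫ e^{v²} → +∞`, then `Λ → 0`. -/
theorem Lambda_tendsto_zero
    (Ω : Set E2) (hΩo : IsOpen Ω) (hΩb : IsBounded Ω) (hΩc : IsConnected Ω)
    (lam1 : ℝ) (hlam1 : 0 < lam1)
    (v : ℕ → E2 → ℝ) (A L : ℕ → ℝ)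
    (hA : ∀ n, 0 ≤ A n ∧ A n < lam1) (hLpos : ∀ n, 0 < L n)
    (hsm : ∀ n, ContDiffOn ℝ (⊤ : ℕ∞) (v n) Ω)
    (hct : ∀ n, ContinuousOn (v n) (closure Ω))
    (hpos : ∀ n, ∀ y ∈ Ω, 0 < v n y)
    (hpde : ∀ n, ∀ y ∈ Ω, lapl (v n) y = v n y * (A n + L n * Real.exp ((v n y) ^ 2)))
    (hbd : ∀ n, ∀ y ∈ frontier Ω, v n y = 0)
    (hgint : ∀ n, IntegrableOn (fun y => ‖gradient (v n) y‖ ^ 2) Ω)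
    (henergy : Tendsto (fun n => ∫ y in Ω, ‖gradient (v n) y‖ ^ 2) atTop (𝓝 (4 * Real.pi)))
    (hAlim : Tendsto A atTop (𝓝 lam1))
    (hL2 : Tendsto (fun n => ∫ y in Ω, (v n y) ^ 2) atTop (𝓝 0))
    (hexp : Tendsto (fun n => ∫ y in Ω, Real.exp ((v n y) ^ 2)) atTop atTop) :
    Tendsto L atTop (𝓝 0) := by
  have hmain (n : ℕ) : L n * ((∫ y in Ω, Real.exp ((v n y) ^ 2)) - volume.real Ω) ≤
      ∫ y in Ω, ‖gradient (v n) y‖ ^ 2 := by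
    have hint {g : E2 → ℝ} (hg : ContinuousOn g (closure Ω)) : IntegrableOn g Ω :=
      (hg.integrableOn_compact hΩb.isCompact_closure).mono_set subset_closure
    have hv := hct n
    have hf : ContinuousOn (fun y => v n y * (A n + L n * Real.exp ((v n y) ^ 2))) (closure Ω) := by
      fun_prop
    have he : IntegrableOn (fun y => Real.exp ((v n y) ^ 2)) Ω := hint (by fun_prop)
    have h1 : IntegrableOn (fun _ : E2 => (1 : ℝ)) Ω := hint continuousOn_const
    refine le_trans ?_ (setIntegral_mul_lapl_le hΩo hΩb (hsm n) hv (hbd n) hf (fun y hy => ?_)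
      (hpde n) (hgint n))
    · have hvol : ∫ _ in Ω, (1 : ℝ) = volume.real Ω := by simp
      rw [← hvol, ← integral_sub he h1, ← MeasureTheory.integral_const_mul]
      refine setIntegral_mono_on ((he.sub h1).const_mul _) (hint (hv.mul hf)) hΩo.measurableSet
        fun y _ => ?_
      have hexp_le : Real.exp ((v n y) ^ 2) - 1 ≤ (v n y) ^ 2 * Real.exp ((v n y) ^ 2) := by
        have h := mul_le_mul_of_nonneg_right (Real.one_sub_le_exp_neg ((v n y) ^ 2))
          (Real.exp_pos ((v n y) ^ 2)).le
        rw [← Real.exp_add, neg_add_cancel, Real.exp_zero] at h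
        linarith
      have h2 := mul_le_mul_of_nonneg_left hexp_le (hLpos n).le
      have h3 := mul_nonneg (hA n).1 (sq_nonneg (v n y))
      show _ ≤ v n y * (v n y * (A n + L n * Real.exp ((v n y) ^ 2)))
      linarith
    · have := hpos n y hy
      have := (hA n).1
      have := hLpos n
      positivity
  have hD := tendsto_atTop_add_const_right atTop (-volume.real Ω) hexp
  refine squeeze_zero' (.of_forall fun n => (hLpos n).le) ?_ (henergy.div_atTop hD)
  filter_upwards [hD.eventually_gt_atTop 0] with n hn
  exact (le_div_iff₀ hn).2 (by simpa [sub_eq_add_neg] using hmain n)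
end
end

section
/- Let δ ∈ (0,1). Under the blow-up assumptions, for every choice of points z_α ∈ B_{x_α}(r_{α,δ}) the radial bubble satisfies the expansion B_α(z_α) = γ_α − t_α(z_α)/γ_α + S_α(z_α)/γ_α³ + O((1 + t_α(z_α))/γ_α⁵) for all α sufficiently close to λ₁. In particular, B_α is radially decreasing in B_{x_α}(r_{α,δ}). -/
open MeasureTheory intervalIntegral Real Filter Topology Metric Bornology RealInnerProductSpace

noncomputable section

/-- Radial profile of the standard Liouville bubble: `T₀(s) = log(1+s²)`. -/
def T0 (s : ℝ) : ℝ := Real.log (1 + s ^ 2)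

/-- Explicit radial solution `S₀` of `ΔS₀ − 8 e^{−2T₀} S₀ = 4 e^{−2T₀}(T₀² − T₀)`, `S₀(0) = 0`. -/
def S0 (s : ℝ) : ℝ :=
  -T0 s + 2 * s ^ 2 / (1 + s ^ 2) - (1 / 2) * (T0 s) ^ 2
    + ((1 - s ^ 2) / (1 + s ^ 2)) * ∫ t in (1 : ℝ)..(1 + s ^ 2), Real.log t / (1 - t)

theorem le_of_hasDerivAt_nonneg {f f' : ℝ → ℝ} {a b : ℝ} (hab : a ≤ b)
    (hf : ContinuousOn f (Set.Icc a b)) (hd : ∀ s ∈ Set.Ioo a b, HasDerivAt f (f' s) s)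
    (h0 : ∀ s ∈ Set.Ioo a b, 0 ≤ f' s) : f a ≤ f b := by
  have hm : MonotoneOn f (Set.Icc a b) := by
    refine monotoneOn_of_deriv_nonneg (convex_Icc a b) hf ?_ ?_
    · intro t ht
      rw [interior_Icc] at ht
      exact (hd t ht).differentiableAt.differentiableWithinAt
    · intro t ht
      rw [interior_Icc] at ht
      rw [(hd t ht).deriv]
      exact h0 t ht
  exact hm (Set.left_mem_Icc.2 hab) (Set.right_mem_Icc.2 hab) hab

/-- The dilogarithm-type integral in `S0`. -/
def logInt (s : ℝ) : ℝ := ∫ t in (1 : ℝ)..(1 + s ^ 2), Real.log t / (1 - t)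

theorem abs_log_div_le {t : ℝ} (ht : 1 ≤ t) : |Real.log t / (1 - t)| ≤ 1 := by
  rcases ht.eq_or_lt with rfl | h
  · simp
  rw [abs_div, abs_of_nonneg (Real.log_nonneg ht), abs_of_neg (by linarith)]
  rw [div_le_one (by linarith)]
  have := Real.log_le_sub_one_of_pos (show 0 < t by linarith)
  linarith

theorem abs_logInt_le (s : ℝ) : |logInt s| ≤ s ^ 2 := by
  have h := intervalIntegral.norm_integral_le_of_norm_le_const (a := 1) (b := 1 + s ^ 2) (C := 1)
    (f := fun t => Real.log t / (1 - t)) (by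
      intro t ht
      rw [Set.uIoc_of_le (by nlinarith [sq_nonneg s])] at ht
      exact abs_log_div_le ht.1.le)
  simpa [logInt, Real.norm_eq_abs] using h

theorem intervalIntegrable_log_div {b : ℝ} (hb : 1 ≤ b) :
    IntervalIntegrable (fun t => Real.log t / (1 - t)) volume 1 b := by
  rw [intervalIntegrable_iff_integrableOn_Ioc_of_le hb]
  refine Measure.integrableOn_of_bounded (M := 1) (by simp) ?_ ?_
  · exact (Measurable.div Real.measurable_log (by fun_prop)).aestronglyMeasurable
  · refine (ae_restrict_iff' measurableSet_Ioc).2 (Filter.Eventually.of_forall fun t ht => ?_)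
    exact abs_log_div_le ht.1.le

theorem hasDerivAt_logInt {s : ℝ} (hs : 0 < s) :
    HasDerivAt logInt (-(2 * T0 s / s)) s := by
  have hb : (1 : ℝ) < 1 + s ^ 2 := by nlinarith [pow_pos hs 2]
  have hc : ContinuousAt (fun t => Real.log t / (1 - t)) (1 + s ^ 2) := by
    refine ContinuousAt.div (Real.continuousAt_log (by linarith)) (by fun_prop) (by linarith)
  have h1 : HasDerivAt (fun u => ∫ t in (1 : ℝ)..u, Real.log t / (1 - t))
      (Real.log (1 + s ^ 2) / (1 - (1 + s ^ 2))) (1 + s ^ 2) := by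
    refine intervalIntegral.integral_hasDerivAt_right (intervalIntegrable_log_div hb.le) ?_ hc
    exact (Measurable.stronglyMeasurable
      (Measurable.div Real.measurable_log (by fun_prop))).stronglyMeasurableAtFilter
  have h2 : HasDerivAt (fun s : ℝ => 1 + s ^ 2) (2 * s) s := by
    simpa using (hasDerivAt_pow 2 s).const_add 1
  have h3 := h1.comp s h2
  refine h3.congr_deriv ?_
  unfold T0
  field_simp
  ring_nf

theorem T0_nonneg (s : ℝ) : 0 ≤ T0 s := Real.log_nonneg (by nlinarith [sq_nonneg s])

theorem T0_le_sq (s : ℝ) : T0 s ≤ s ^ 2 := by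
  have := Real.log_le_sub_one_of_pos (show 0 < 1 + s ^ 2 by positivity)
  unfold T0; linarith

theorem exp_T0 (s : ℝ) : Real.exp (T0 s) = 1 + s ^ 2 := Real.exp_log (by positivity)

theorem hasDerivAt_T0 (s : ℝ) : HasDerivAt T0 (2 * s / (1 + s ^ 2)) s := by
  have h2 : HasDerivAt (fun s : ℝ => 1 + s ^ 2) (2 * s) s := by
    simpa using (hasDerivAt_pow 2 s).const_add 1
  exact h2.log (by positivity)

theorem S0_eq (s : ℝ) : S0 s = -T0 s + 2 * s ^ 2 / (1 + s ^ 2) - (1 / 2) * (T0 s) ^ 2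
    + ((1 - s ^ 2) / (1 + s ^ 2)) * logInt s := rfl

/-- The flux `s S₀'(s)` of the radial function `S₀`. -/
def fluxS0 (s : ℝ) : ℝ :=
  (-2 * s ^ 2 - 2 * T0 s) / (1 + s ^ 2) + (4 * s ^ 2 - 4 * s ^ 2 * logInt s) / (1 + s ^ 2) ^ 2

theorem hasDerivAt_S0 {s : ℝ} (hs : 0 < s) : HasDerivAt S0 (fluxS0 s / s) s := by
  have hq : HasDerivAt (fun s : ℝ => 1 + s ^ 2) (2 * s) s := by
    simpa using (hasDerivAt_pow 2 s).const_add 1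
  have hsq : HasDerivAt (fun s : ℝ => s ^ 2) (2 * s) s := by
    simpa using (hasDerivAt_pow 2 s)
  have hT := hasDerivAt_T0 s
  have hJ := hasDerivAt_logInt hs
  have hne : 1 + s ^ 2 ≠ 0 := by positivity
  have h := ((hT.neg.add ((hsq.const_mul 2).div hq hne)).sub ((hT.pow 2).const_mul (1 / 2))).add
    (((hsq.const_sub 1).div hq hne).mul hJ)
  refine (h.congr_of_eventuallyEq (f₁ := S0) (Filter.Eventually.of_forall fun t => ?_)).congr_deriv ?_
  · simp [S0_eq]
  · unfold fluxS0
    simp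
    field_simp
    ring

theorem hasDerivAt_fluxS0 {s : ℝ} (hs : 0 < s) :
    HasDerivAt fluxS0 (-(s * (4 * Real.exp (-2 * T0 s) * (T0 s ^ 2 - T0 s + 2 * S0 s)))) s := by
  have hq : HasDerivAt (fun s : ℝ => 1 + s ^ 2) (2 * s) s := by
    simpa using (hasDerivAt_pow 2 s).const_add 1
  have hsq : HasDerivAt (fun s : ℝ => s ^ 2) (2 * s) s := by
    simpa using (hasDerivAt_pow 2 s)
  have hT := hasDerivAt_T0 s
  have hJ := hasDerivAt_logInt hs
  have hne : 1 + s ^ 2 ≠ 0 := by positivity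
  have h := (((hsq.const_mul (-2)).sub (hT.const_mul 2)).div hq hne).add
    (((hsq.const_mul 4).sub ((hsq.const_mul 4).mul hJ)).div (hq.pow 2) (pow_ne_zero 2 hne))
  refine (h.congr_of_eventuallyEq (f₁ := fluxS0) (Filter.Eventually.of_forall fun t => ?_)).congr_deriv ?_
  · simp [fluxS0]
  · have he : Real.exp (-2 * T0 s) = 1 / (1 + s ^ 2) ^ 2 := by
      rw [show -2 * T0 s = -(T0 s + T0 s) by ring, Real.exp_neg, Real.exp_add, exp_T0]
      field_simp
    rw [he, S0_eq]
    simp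
    field_simp
    ring

theorem abs_fluxS0_le (s : ℝ) : |fluxS0 s| ≤ 12 * (s ^ 2 / (1 + s ^ 2)) := by
  have hq : 0 < 1 + s ^ 2 := by positivity
  have hJ := abs_le.1 (abs_logInt_le s)
  have hT := T0_le_sq s
  have hT' := T0_nonneg s
  have hs := sq_nonneg s
  have e : fluxS0 s = ((-2 * s ^ 2 - 2 * T0 s) * (1 + s ^ 2) + 4 * s ^ 2 - 4 * s ^ 2 * logInt s)
      / (1 + s ^ 2) ^ 2 := by
    unfold fluxS0; field_simp; ring
  have e2 : 12 * (s ^ 2 / (1 + s ^ 2)) = 12 * s ^ 2 * (1 + s ^ 2) / (1 + s ^ 2) ^ 2 := by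
    field_simp
  rw [e, e2, abs_div, abs_of_pos (show 0 < (1 + s ^ 2) ^ 2 by positivity)]
  gcongr
  rw [abs_le]
  constructor <;> nlinarith [mul_nonneg hs (sub_nonneg.2 hJ.2), mul_nonneg hs hs,
    mul_nonneg hs (sub_nonneg.2 hT), mul_nonneg hs hT', mul_nonneg hs (sub_nonneg.2 hJ.1)]

theorem continuousOn_logInt : ContinuousOn logInt (Set.Ici 0) := by
  intro s hs
  rcases (Set.mem_Ici.1 hs).eq_or_lt with rfl | h
  · have h0 : logInt 0 = 0 := by simp [logInt]
    refine ContinuousAt.continuousWithinAt ?_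
    rw [ContinuousAt, h0]
    refine squeeze_zero_norm (a := fun s => s ^ 2) abs_logInt_le ?_
    have : ContinuousAt (fun s : ℝ => s ^ 2) 0 := by fun_prop
    simpa [ContinuousAt] using this
  · exact (hasDerivAt_logInt h).continuousAt.continuousWithinAt

theorem continuous_T0 : Continuous T0 :=
  continuous_iff_continuousAt.2 fun s => (hasDerivAt_T0 s).continuousAt

theorem continuousOn_S0 : ContinuousOn S0 (Set.Ici 0) := by
  have hT := continuous_T0.continuousOn (s := Set.Ici 0)
  have hJ := continuousOn_logInt
  have h1 : ContinuousOn (fun s : ℝ => 2 * s ^ 2 / (1 + s ^ 2)) (Set.Ici 0) :=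
    ContinuousOn.div (by fun_prop) (by fun_prop) fun s _ => by positivity
  have h2 : ContinuousOn (fun s : ℝ => (1 - s ^ 2) / (1 + s ^ 2)) (Set.Ici 0) :=
    ContinuousOn.div (by fun_prop) (by fun_prop) fun s _ => by positivity
  exact ((hT.neg.add h1).sub ((hT.pow 2).const_smul (1 / 2 : ℝ))).add (h2.mul hJ)

theorem continuousOn_fluxS0 : ContinuousOn fluxS0 (Set.Ici 0) := by
  have hT := continuous_T0.continuousOn (s := Set.Ici 0)
  have hJ := continuousOn_logInt
  refine ContinuousOn.add (ContinuousOn.div ?_ (by fun_prop) fun s _ => by positivity)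
    (ContinuousOn.div ?_ (by fun_prop) fun s _ => by positivity)
  · fun_prop
  · fun_prop

theorem S0_zero : S0 0 = 0 := by simp [S0, T0]

theorem T0_zero : T0 0 = 0 := by simp [T0]

theorem abs_S0_le {s : ℝ} (hs : 0 ≤ s) : |S0 s| ≤ 6 * T0 s := by
  have hcont : ContinuousOn S0 (Set.Icc 0 s) := continuousOn_S0.mono Set.Icc_subset_Ici_self
  have hmono : ∀ c : ℝ, |c| ≤ 1 → c * S0 s ≤ 6 * T0 s := by
    intro c hc
    have h := le_of_hasDerivAt_nonneg (f := fun t => 6 * T0 t - c * S0 t) hs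
      ((continuous_T0.continuousOn.const_smul (6 : ℝ)).sub (hcont.const_smul c))
      (fun t ht => ((hasDerivAt_T0 t).const_mul 6).sub ((hasDerivAt_S0 ht.1).const_mul c)) (by
        intro t ht
        have h1 : c * (fluxS0 t / t) ≤ 12 * (t ^ 2 / (1 + t ^ 2)) / t := by
          rw [← mul_div_assoc]
          refine div_le_div_of_nonneg_right ?_ ht.1.le
          refine (le_abs_self _).trans ?_
          rw [abs_mul]
          calc |c| * |fluxS0 t| ≤ 1 * |fluxS0 t| := by gcongr
            _ ≤ _ := by rw [one_mul]; exact abs_fluxS0_le t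
        have h2 : 12 * (t ^ 2 / (1 + t ^ 2)) / t = 6 * (2 * t / (1 + t ^ 2)) := by
          have := ht.1
          field_simp
          ring
        linarith)
    simp only [T0_zero, S0_zero] at h
    linarith
  rw [abs_le]
  have h1 := hmono 1 (by simp)
  have h2 := hmono (-1) (by simp)
  constructor <;> linarith

theorem gronwall_radial {R c η a b : ℝ} (hη : 0 < η) (hc : 0 ≤ c) (ha : 0 ≤ a) (hb : 0 ≤ b)
    {E E' G : ℝ → ℝ} (hE : ContinuousOn E (Set.Ico 0 R)) (hE0 : E 0 = 0)
    (hE' : ∀ s ∈ Set.Ioo 0 R, HasDerivAt E (E' s) s)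
    (hP : ContinuousOn (fun s => s * E' s) (Set.Ico 0 R))
    (hP' : ∀ s ∈ Set.Ioo 0 R, HasDerivAt (fun s => s * E' s) (s * G s) s)
    (hG : ContinuousOn G (Set.Ico 0 R))
    (hGb : ∀ s ∈ Set.Ioo 0 R, (1 + s) * |G s| ≤
      c * (1 + s) ^ (-(1 + η)) * (|E s| / (1 + T0 s) + a) + b * (1 + s)) :
    ∀ s ∈ Set.Ico 0 R, |E s| ≤ (1 + T0 s) * (Real.exp (c / η) * (a + b * (1 + s) ^ 2)) := by
  rintro s₁ ⟨hs₁, hs₁R⟩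
  have hsub : Set.Icc 0 s₁ ⊆ Set.Ico 0 R := fun t ht => ⟨ht.1, ht.2.trans_lt hs₁R⟩
  set H : ℝ → ℝ := Set.IccExtend hs₁ (Set.domRestrict (Set.Icc 0 s₁) G) with hH
  have hHc : Continuous H :=
    (continuousOn_iff_continuous_domRestrict.1 (hG.mono hsub)).Icc_extend'
  have hHG : ∀ t ∈ Set.Ioo 0 s₁, H t = G t := fun t ht => by
    rw [hH, Set.IccExtend_of_mem hs₁ _ (Set.Ioo_subset_Icc_self ht)]; rfl
  set g : ℝ → ℝ := fun s => ∫ t in (0 : ℝ)..s, (1 + t) * |H t| with hg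
  have hgd : ∀ s, HasDerivAt g ((1 + s) * |H s|) s := fun s =>
    ((by fun_prop : Continuous fun t => (1 + t) * |H t|).integral_hasStrictDerivAt 0 s).hasDerivAt
  have hgc : Continuous g := continuous_iff_continuousAt.2 fun s => (hgd s).continuousAt
  have hg0 : g 0 = 0 := by simp [hg]
  have hgnn : ∀ s, 0 ≤ s → 0 ≤ g s := fun s hs =>
    intervalIntegral.integral_nonneg hs fun t ht => mul_nonneg (by linarith [ht.1]) (abs_nonneg _)
  have key1 : ∀ d : ℝ, |d| ≤ 1 → ∀ s ∈ Set.Ioo 0 s₁, d * E' s ≤ g s / (1 + s) := by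
    intro d hd s hs
    have h := le_of_hasDerivAt_nonneg
      (f := fun t => t / (1 + t) * g t - d * (t * E' t)) (a := 0) (b := s)
      (f' := fun t => (1 * (1 + t) - t * 1) / (1 + t) ^ 2 * g t +
        t / (1 + t) * ((1 + t) * |H t|) - d * (t * G t)) hs.1.le ?_ ?_ ?_
    · simp only [zero_div, zero_mul, mul_zero, sub_zero] at h
      have h1 : s * (d * E' s) ≤ s * (g s / (1 + s)) := by
        calc s * (d * E' s) = d * (s * E' s) := by ring
          _ ≤ s / (1 + s) * g s := by linarith
          _ = _ := by ring
      exact le_of_mul_le_mul_left h1 hs.1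
    · refine ContinuousOn.sub (ContinuousOn.mul (ContinuousOn.div (by fun_prop) (by fun_prop) ?_)
        hgc.continuousOn) ((hP.mono ?_).const_smul d)
      · intro t ht; linarith [ht.1]
      · exact fun t ht => ⟨ht.1, by linarith [ht.2, hs.2]⟩
    · intro t ht
      refine (((hasDerivAt_id t).div ((hasDerivAt_id t).const_add 1) (by simp; linarith [ht.1])).mul
        (hgd t)).sub ((hP' t ⟨ht.1, by linarith [ht.2, hs.2]⟩).const_mul d)
    · intro t ht
      have ht0 := ht.1
      have h1 : 0 ≤ (1 * (1 + t) - t * 1) / (1 + t) ^ 2 * g t :=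
        mul_nonneg (div_nonneg (by linarith) (by positivity)) (hgnn t ht0.le)
      have h2 : t / (1 + t) * ((1 + t) * |H t|) = t * |H t| := by field_simp
      have h3 : d * (t * G t) ≤ t * |H t| := by
        rw [hHG t ⟨ht.1, ht.2.trans hs.2⟩]
        calc d * (t * G t) ≤ |d * (t * G t)| := le_abs_self _
          _ = |d| * (t * |G t|) := by rw [abs_mul, abs_mul, abs_of_pos ht0]
          _ ≤ 1 * (t * |G t|) := by gcongr
          _ = _ := one_mul _
      linarith
  have key2 : ∀ d : ℝ, |d| ≤ 1 → ∀ s ∈ Set.Icc 0 s₁, d * E s ≤ Real.log (1 + s) * g s := by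
    intro d hd s hs
    have h := le_of_hasDerivAt_nonneg
      (f := fun t => Real.log (1 + t) * g t - d * E t) (a := 0) (b := s)
      (f' := fun t => 1 / (1 + t) * g t +
        Real.log (1 + t) * ((1 + t) * |H t|) - d * E' t) hs.1 ?_ ?_ ?_
    · simp only [hg0, hE0, mul_zero, sub_zero] at h
      linarith
    · refine ContinuousOn.sub (ContinuousOn.mul (ContinuousOn.log (by fun_prop) ?_)
        hgc.continuousOn) ((hE.mono ?_).const_smul d)
      · intro t ht; linarith [ht.1]
      · exact fun t ht => ⟨ht.1, by linarith [ht.2, hs.2]⟩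
    · intro t ht
      exact ((((hasDerivAt_id t).const_add 1).log (by simp; linarith [ht.1])).mul
        (hgd t)).sub ((hE' t ⟨ht.1, by linarith [ht.2, hs.2]⟩).const_mul d)
    · intro t ht
      have ht0 := ht.1
      have h1 := key1 d hd t ⟨ht0, by linarith [ht.2, hs.2]⟩
      have h2 : 0 ≤ Real.log (1 + t) * ((1 + t) * |H t|) :=
        mul_nonneg (Real.log_nonneg (by linarith)) (by positivity)
      have h3 : 1 / (1 + t) * g t = g t / (1 + t) := by ring
      linarith
  have hlog : ∀ s, 0 ≤ s → Real.log (1 + s) ≤ 1 + T0 s := by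
    intro s hs
    rw [Real.log_le_iff_le_exp (by linarith), Real.exp_add, exp_T0]
    have : (2 : ℝ) ≤ Real.exp 1 := by linarith [Real.add_one_le_exp (1 : ℝ)]
    nlinarith [sq_nonneg (s - 1), sq_nonneg s]
  have key3 : ∀ s ∈ Set.Icc 0 s₁, |E s| ≤ (1 + T0 s) * g s := by
    intro s hs
    have h1 := key2 1 (by simp) s hs
    have h2 := key2 (-1) (by simp) s hs
    have h3 : |E s| ≤ Real.log (1 + s) * g s := by rw [abs_le]; constructor <;> linarith
    exact h3.trans (mul_le_mul_of_nonneg_right (hlog s hs.1) (hgnn s hs.1))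
  set K : ℝ → ℝ := fun s => c / η * (1 - (1 + s) ^ (-η)) with hK
  have hKd : ∀ s, 0 ≤ s → HasDerivAt K (c * (1 + s) ^ (-(1 + η))) s := by
    intro s hs
    have h1 : HasDerivAt (fun s : ℝ => (1 + s) ^ (-η)) (1 * (-η) * (1 + s) ^ (-η - 1)) s :=
      ((hasDerivAt_id s).const_add 1).rpow_const (Or.inl (by simp; linarith))
    refine ((h1.const_sub 1).const_mul (c / η)).congr_deriv ?_
    rw [show -(1 + η) = -η - 1 by ring]
    field_simp
  have hK0 : ∀ s, 0 ≤ s → 0 ≤ K s := by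
    intro s hs
    have : (1 + s) ^ (-η) ≤ 1 := Real.rpow_le_one_of_one_le_of_nonpos (by linarith) (by linarith)
    exact mul_nonneg (by positivity) (by linarith)
  have hK1 : ∀ s, 0 ≤ s → K s ≤ c / η := by
    intro s hs
    have : 0 ≤ (1 + s) ^ (-η) := by positivity
    have : 0 ≤ c / η := by positivity
    simp only [hK]; nlinarith
  have key4 : (g s₁ + a) * Real.exp (-K s₁) ≤ a + b * (1 + s₁) ^ 2 := by
    have h := le_of_hasDerivAt_nonneg
      (f := fun t => b * (1 + t) ^ 2 - (g t + a) * Real.exp (-K t)) (a := 0) (b := s₁)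
      (f' := fun t => b * (2 * (1 + t)) - ((1 + t) * |H t| * Real.exp (-K t) +
        (g t + a) * (Real.exp (-K t) * (-(c * (1 + t) ^ (-(1 + η))))))) hs₁ ?_ ?_ ?_
    · have hK00 : K 0 = 0 := by simp [hK]
      simp only [hg0, hK00] at h
      norm_num at h
      linarith
    · refine ContinuousOn.sub (by fun_prop) ((hgc.add continuous_const).continuousOn.mul ?_)
      refine ContinuousOn.rexp (ContinuousOn.neg fun t ht => ?_)
      exact (hKd t ht.1).continuousAt.continuousWithinAt
    · intro t ht
      have h2 : HasDerivAt (fun t : ℝ => (1 + t) ^ 2) (2 * (1 + t)) t := by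
        simpa using ((hasDerivAt_id t).const_add 1).fun_pow 2
      exact (h2.const_mul b).sub (((hgd t).add_const a).mul (hKd t ht.1.le).neg.exp)
    · intro t ht
      have ht0 := ht.1
      have hgb := hGb t ⟨ht0, ht.2.trans hs₁R⟩
      have hT : 0 < 1 + T0 t := by linarith [T0_nonneg t]
      have hEg : |E t| / (1 + T0 t) ≤ g t := by
        rw [div_le_iff₀ hT, mul_comm]
        exact key3 t (Set.Ioo_subset_Icc_self ht)
      have hk : 0 ≤ c * (1 + t) ^ (-(1 + η)) := by positivity
      have h1 : (1 + t) * |H t| - (g t + a) * (c * (1 + t) ^ (-(1 + η))) ≤ b * (1 + t) := by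
        rw [hHG t ht]
        nlinarith
      have he0 := Real.exp_pos (-K t)
      have he1 : Real.exp (-K t) ≤ 1 := Real.exp_le_one_iff.2 (by linarith [hK0 t ht0.le])
      have hbt : 0 ≤ b * (1 + t) := by positivity
      nlinarith
  have hfin : g s₁ ≤ Real.exp (c / η) * (a + b * (1 + s₁) ^ 2) := by
    have h1 : (g s₁ + a) = (g s₁ + a) * Real.exp (-K s₁) * Real.exp (K s₁) := by
      rw [mul_assoc, ← Real.exp_add]; simp
    have h2 : (g s₁ + a) * Real.exp (-K s₁) * Real.exp (K s₁) ≤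
        (a + b * (1 + s₁) ^ 2) * Real.exp (c / η) := by
      gcongr
      exact hK1 s₁ hs₁
    linarith
  calc |E s₁| ≤ (1 + T0 s₁) * g s₁ := key3 s₁ (Set.right_mem_Icc.2 hs₁)
    _ ≤ _ := by
      gcongr
      linarith [T0_nonneg s₁]

theorem abs_exp_sub_one_le (z : ℝ) : |Real.exp z - 1| ≤ |z| * Real.exp |z| := by
  have h := Complex.norm_exp_sub_sum_le_norm_mul_exp (z : ℂ) 1
  simp only [Finset.sum_range_one, pow_zero, Nat.factorial_zero, Nat.cast_one, div_one, pow_one,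
    Complex.norm_real, Real.norm_eq_abs] at h
  rwa [← Complex.ofReal_exp, ← Complex.ofReal_one, ← Complex.ofReal_sub, Complex.norm_real] at h

theorem abs_exp_sub_one_sub_le (z : ℝ) : |Real.exp z - 1 - z| ≤ z ^ 2 * Real.exp |z| := by
  have h := Complex.norm_exp_sub_sum_le_norm_mul_exp (z : ℂ) 2
  simp only [Finset.sum_range_succ, Finset.sum_range_zero, zero_add, pow_zero, Nat.factorial_zero,
    Nat.cast_one, div_one, pow_one, Nat.factorial_one, Complex.norm_real, Real.norm_eq_abs,
    sq_abs] at h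
  rwa [← Complex.ofReal_exp, ← Complex.ofReal_one, ← Complex.ofReal_add, ← Complex.ofReal_sub,
    Complex.norm_real, ← sub_sub] at h

set_option maxHeartbeats 400000 in
theorem bubble_taylor {δ ε T S E w : ℝ} (hδ1 : δ < 1) (hε0 : 0 < ε) (hε1 : ε ≤ 1)
    (hT : 0 ≤ T) (hεT : ε * T ≤ δ) (hS : |S| ≤ 6 * T) (hE : |E| ≤ 1) (hw : w = T - ε * S + E) :
    |4 * (1 - ε * w) * Real.exp (-2 * w + ε * w ^ 2)
        - 4 * Real.exp (-2 * T) * (1 + ε * (T ^ 2 - T + 2 * S))|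
      ≤ 30000 * Real.exp 77 * Real.exp (-(2 - δ) * T) * (|E| + ε ^ 2 * (1 + T) ^ 4) ∧
    |1 - ε * w| ≤ 10 := by
  set D := E - ε * S with hD
  set X := |E| + ε ^ 2 * (1 + T) ^ 4 with hX
  have ha := abs_nonneg E
  have hεT1 : ε * T ≤ 1 := by linarith
  have hεT0 : 0 ≤ ε * T := by positivity
  have hεS : |ε * S| ≤ 6 * (ε * T) := by
    rw [abs_mul, abs_of_pos hε0]; nlinarith
  have hDle : |D| ≤ |E| + 6 * (ε * T) := (abs_sub _ _).trans (by linarith)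
  have hD7 : |D| ≤ 7 := by linarith
  have hD0 := abs_nonneg D
  have hwD : w = T + D := by rw [hw, hD]; ring
  have hp1 : T ≤ (1 + T) ^ 4 := by
    linarith only [hT, sq_nonneg T, sq_nonneg (T ^ 2), pow_nonneg hT 3]
  have hp2 : T ^ 2 ≤ (1 + T) ^ 4 := by
    linarith only [hT, sq_nonneg T, sq_nonneg (T ^ 2), pow_nonneg hT 3]
  have hp3 : T * (1 + T) ^ 2 ≤ (1 + T) ^ 4 := by
    linarith only [hT, sq_nonneg T, sq_nonneg (T ^ 2), pow_nonneg hT 3]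
  have hε2 : 0 < ε ^ 2 := by positivity
  have hXT1 : |E| + ε ^ 2 * T ≤ X := by
    rw [hX]; linarith [mul_le_mul_of_nonneg_left hp1 hε2.le]
  have hXT2 : |E| + ε ^ 2 * T ^ 2 ≤ X := by
    rw [hX]; linarith [mul_le_mul_of_nonneg_left hp2 hε2.le]
  have hXT3 : |E| + ε ^ 2 * (T * (1 + T) ^ 2) ≤ X := by
    rw [hX]; linarith [mul_le_mul_of_nonneg_left hp3 hε2.le]
  have hX4 : ε ^ 2 * (1 + T) ^ 4 ≤ X := by rw [hX]; linarith
  have hX0 : 0 ≤ X := by rw [hX]; positivity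
  have hXE : |E| ≤ X := by rw [hX]; linarith [show 0 ≤ ε ^ 2 * (1 + T) ^ 4 by positivity]
  set z := -2 * E + 2 * (ε * S) + ε * w ^ 2 with hz
  set z₁ := ε * (T ^ 2 + 2 * S) with hz₁
  set e₁ := -2 * E + 2 * (ε * T) * D + ε * D ^ 2 with he₁
  have hze : z = z₁ + e₁ := by rw [hz, hz₁, he₁, hwD, hD]; ring
  have habs : |e₁| ≤ 2 * |E| + 2 * (ε * T) * |D| + ε * |D| ^ 2 := by
    rw [he₁]
    refine (abs_add_le _ _).trans (add_le_add ((abs_add_le _ _).trans (add_le_add ?_ ?_)) ?_)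
    · rw [abs_mul]; norm_num
    · rw [abs_mul, abs_of_nonneg (by positivity)]
    · rw [abs_mul, abs_of_pos hε0, abs_pow]
  have hTD : ε * T * |D| ≤ ε * T * |E| + 6 * (ε ^ 2 * T ^ 2) := by
    calc ε * T * |D| ≤ ε * T * (|E| + 6 * (ε * T)) := mul_le_mul_of_nonneg_left hDle hεT0
      _ = _ := by ring
  have hDD : ε * |D| ^ 2 ≤ 7 * (ε * |D|) := by
    calc ε * |D| ^ 2 = |D| * (ε * |D|) := by ring
      _ ≤ _ := mul_le_mul_of_nonneg_right hD7 (by positivity)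
  have hεD : ε * |D| ≤ ε * |E| + 6 * (ε ^ 2 * T) := by
    calc ε * |D| ≤ ε * (|E| + 6 * (ε * T)) := mul_le_mul_of_nonneg_left hDle hε0.le
      _ = _ := by ring
  have hεE : ε * |E| ≤ |E| := mul_le_of_le_one_left ha hε1
  have hεD1 : ε * |D| ≤ |D| := mul_le_of_le_one_left hD0 hε1
  have hTE : ε * T * |E| ≤ |E| := mul_le_of_le_one_left ha hεT1
  have hTD1 : ε * T * |D| ≤ |D| := mul_le_of_le_one_left hD0 hεT1
  have he65 : |e₁| ≤ 65 := by linarith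
  have heX : |e₁| ≤ 54 * X := by
    linarith
  have hz₁le : |z₁| ≤ 12 * ε * (1 + T) ^ 2 := by
    have : |z₁| ≤ ε * (T ^ 2 + 2 * (6 * T)) := by
      rw [hz₁, abs_mul, abs_of_pos hε0]
      gcongr
      refine (abs_add_le _ _).trans ?_
      rw [abs_of_nonneg (sq_nonneg T), abs_mul 2]; norm_num; linarith only [hS]
    have h2 : ε * (T ^ 2 + 2 * (6 * T)) ≤ ε * (12 * (1 + T) ^ 2) :=
      mul_le_mul_of_nonneg_left (by linarith only [hT, sq_nonneg T]) hε0.le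
    linarith only [this, h2]
  have hzle : |z| ≤ 77 + δ * T := by
    have h1 : |z₁| ≤ 12 + δ * T := by
      have : |z₁| ≤ ε * T ^ 2 + 2 * |ε * S| := by
        rw [hz₁, mul_add]
        refine (abs_add_le _ _).trans ?_
        rw [abs_of_nonneg (by positivity : 0 ≤ ε * T ^ 2), show ε * (2 * S) = 2 * (ε * S) by ring,
          abs_mul 2]
        norm_num
      have h2 : ε * T ^ 2 ≤ δ * T := by
        calc ε * T ^ 2 = ε * T * T := by ring
          _ ≤ _ := mul_le_mul_of_nonneg_right hεT hT
      linarith only [this, h2, hεS, hεT1]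
    rw [hze]
    exact (abs_add_le _ _).trans (by linarith only [h1, he65])
  set M := Real.exp (77 + δ * T) with hM
  have hzM : Real.exp |z| ≤ M := Real.exp_le_exp.2 hzle
  have hM1 : 1 ≤ M := Real.one_le_exp ((abs_nonneg z).trans hzle)
  have hz2 : z ^ 2 ≤ 7308 * X := by
    have h1 : z ^ 2 ≤ 2 * |z₁| ^ 2 + 2 * |e₁| ^ 2 := by
      rw [hze, sq_abs, sq_abs]; linarith only [sq_nonneg (z₁ - e₁)]
    have h2 : |z₁| ^ 2 ≤ (12 * ε * (1 + T) ^ 2) ^ 2 := by gcongr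
    have h3 : (12 * ε * (1 + T) ^ 2) ^ 2 = 144 * (ε ^ 2 * (1 + T) ^ 4) := by ring
    have h4 : |e₁| ^ 2 ≤ 65 * |e₁| := by
      rw [sq]; exact mul_le_mul_of_nonneg_right he65 (abs_nonneg _)
    linarith only [h1, h2, h3, h4, heX, hX4]
  have hA : |Real.exp z - 1 - z₁| ≤ 7362 * X * M := by
    have h1 : Real.exp z - 1 - z₁ = (Real.exp z - 1 - z) + e₁ := by rw [hze]; ring
    have h2 : z ^ 2 * Real.exp |z| ≤ 7308 * X * M := by gcongr
    rw [h1]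
    refine (abs_add_le _ _).trans ?_
    have h3 := abs_exp_sub_one_sub_le z
    have h4 : 54 * X ≤ 54 * X * M := le_mul_of_one_le_right (by positivity) hM1
    linarith
  have hB : ε * T * |Real.exp z - 1| ≤ 66 * X * M := by
    have h1 : |z| ≤ 12 * ε * (1 + T) ^ 2 + |e₁| := by
      rw [hze]; exact (abs_add_le _ _).trans (by linarith)
    have h2 : ε * T * |z| ≤ 66 * X := by
      have : ε * T * |z| ≤ ε * T * (12 * ε * (1 + T) ^ 2 + |e₁|) := by gcongr
      have h3 : ε * T * |e₁| ≤ |e₁| :=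
        mul_le_of_le_one_left (abs_nonneg e₁) hεT1
      have h4 : ε * T * (12 * ε * (1 + T) ^ 2) = 12 * (ε ^ 2 * (T * (1 + T) ^ 2)) := by ring
      rw [mul_add, h4] at this
      linarith
    calc ε * T * |Real.exp z - 1| ≤ ε * T * (|z| * Real.exp |z|) := by
          gcongr; exact abs_exp_sub_one_le z
      _ = (ε * T * |z|) * Real.exp |z| := by ring
      _ ≤ 66 * X * M := by gcongr
  have hCC : ε * |D| * Real.exp z ≤ 6 * X * M := by
    have h1 : ε * |D| ≤ 6 * X := by linarith
    have h2 : Real.exp z ≤ M := (Real.exp_le_exp.2 (le_abs_self z)).trans hzM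
    gcongr
  refine ⟨?_, ?_⟩
  · have e1 : Real.exp (-2 * w + ε * w ^ 2) = Real.exp (-2 * T) * Real.exp z := by
      rw [← Real.exp_add]; congr 1; rw [hz, hw]; ring
    have e2 : 4 * (1 - ε * w) * Real.exp (-2 * w + ε * w ^ 2)
        - 4 * Real.exp (-2 * T) * (1 + ε * (T ^ 2 - T + 2 * S)) =
        4 * Real.exp (-2 * T) * ((Real.exp z - 1 - z₁) - ε * D * Real.exp z
          - ε * T * (Real.exp z - 1)) := by
      rw [e1, hwD, hz₁]; ring
    have e3 : 30000 * Real.exp 77 * Real.exp (-(2 - δ) * T) * X =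
        4 * Real.exp (-2 * T) * (7500 * X * M) := by
      have : Real.exp 77 * Real.exp (-(2 - δ) * T) = Real.exp (-2 * T) * M := by
        rw [hM, ← Real.exp_add, ← Real.exp_add]; congr 1; ring
      calc _ = 30000 * (Real.exp 77 * Real.exp (-(2 - δ) * T)) * X := by ring
        _ = _ := by rw [this]; ring
    rw [e2, e3, abs_mul, abs_of_pos (by positivity)]
    gcongr
    have h1 : |ε * D * Real.exp z| = ε * |D| * Real.exp z := by
      rw [abs_mul, abs_mul, abs_of_pos hε0, abs_of_pos (Real.exp_pos z)]
    have h2 : |ε * T * (Real.exp z - 1)| = ε * T * |Real.exp z - 1| := by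
      rw [abs_mul, abs_of_nonneg hεT0]
    have h3 := abs_sub (Real.exp z - 1 - z₁ - ε * D * Real.exp z) (ε * T * (Real.exp z - 1))
    have h4 := abs_sub (Real.exp z - 1 - z₁) (ε * D * Real.exp z)
    have h5 : 0 ≤ X * M := by positivity
    linarith only [h1, h2, h3, h4, h5, hA, hB, hCC]
  · have h1 : ε * |D| ≤ 7 := by linarith
    have h2 : |ε * D| = ε * |D| := by rw [abs_mul, abs_of_pos hε0]
    have h3 := abs_le.1 (h2.trans_le h1)
    rw [hwD, abs_le]
    constructor <;> linarith

theorem one_add_sq_le (s : ℝ) : (1 + s) ^ 2 ≤ 2 * (1 + s ^ 2) := by nlinarith [sq_nonneg (s - 1)]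

/-- The weight `(1 + s) e^{-(2-δ)T₀} (1 + T₀)⁴` is integrable at infinity. -/
theorem weight_decay {δ : ℝ} (hδ1 : δ < 1) : ∃ c : ℝ, 0 < c ∧ ∀ s : ℝ, 0 ≤ s →
    (1 + s) * Real.exp (-(2 - δ) * T0 s) * (1 + T0 s) ^ 4 ≤ c * (1 + s) ^ (-(1 + (1 - δ))) := by
  set η := 1 - δ with hη
  have hη0 : 0 < η := by linarith
  refine ⟨Real.exp (Real.log 2 * (1 + η / 2)) * ((8 / η) ^ 4 * Real.exp (η / 2)), by positivity,
    fun s hs => ?_⟩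
  have h1s : 0 < 1 + s := by linarith
  have hT := T0_nonneg s
  have h1 : Real.log (1 + s) * 2 ≤ Real.log 2 + T0 s := by
    unfold T0
    rw [← Real.log_mul (by norm_num) (by positivity), mul_comm]
    have := Real.log_le_log (by positivity) (one_add_sq_le s)
    rw [Real.log_pow] at this
    exact_mod_cast this
  have h2 : (1 + T0 s) ^ 4 ≤ (8 / η) ^ 4 * Real.exp (η / 2) * Real.exp (η / 2 * T0 s) := by
    have h3 : (1 + T0 s) ≤ 8 / η * Real.exp (η / 8 * (1 + T0 s)) := by
      have := Real.add_one_le_exp (η / 8 * (1 + T0 s))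
      calc 1 + T0 s = 8 / η * (η / 8 * (1 + T0 s)) := by field_simp
        _ ≤ _ := by gcongr; linarith
    calc (1 + T0 s) ^ 4 ≤ (8 / η * Real.exp (η / 8 * (1 + T0 s))) ^ 4 := by gcongr
      _ = _ := by
        rw [mul_pow, ← Real.exp_nat_mul, mul_assoc, ← Real.exp_add]
        congr 2
        push_cast; ring
  have e1 : 1 + s = Real.exp (Real.log (1 + s)) := (Real.exp_log h1s).symm
  have e2 : (1 + s) ^ (-(1 + η)) = Real.exp (Real.log (1 + s) * (-(1 + η))) :=
    Real.rpow_def_of_pos h1s _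
  rw [e2]
  calc (1 + s) * Real.exp (-(2 - δ) * T0 s) * (1 + T0 s) ^ 4
      ≤ Real.exp (Real.log (1 + s)) * Real.exp (-(2 - δ) * T0 s) *
        ((8 / η) ^ 4 * Real.exp (η / 2) * Real.exp (η / 2 * T0 s)) := by
          rw [← e1]; gcongr
    _ = ((8 / η) ^ 4 * Real.exp (η / 2)) * (Real.exp (Real.log (1 + s)) *
        Real.exp (-(2 - δ) * T0 s) * Real.exp (η / 2 * T0 s)) := by ring
    _ ≤ ((8 / η) ^ 4 * Real.exp (η / 2)) * (Real.exp (Real.log 2 * (1 + η / 2)) *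
        Real.exp (Real.log (1 + s) * (-(1 + η)))) := by
          refine mul_le_mul_of_nonneg_left ?_ (by positivity)
          rw [← Real.exp_add, ← Real.exp_add, ← Real.exp_add]
          refine Real.exp_le_exp.2 ?_
          nlinarith
    _ = _ := by ring

/-- Expansion of the rescaled radial bubble profile, in the variables `ε = γ⁻²`, `w = γ(γ - B)`. -/
theorem profile_expansion {δ : ℝ} (hδ0 : 0 < δ) (hδ1 : δ < 1) :
    ∃ C > 0, ∃ ε₀ > 0, ∀ ε, 0 < ε → ε < ε₀ → ∀ (R m : ℝ) (w w' : ℝ → ℝ),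
      ε * T0 R ≤ δ → 0 ≤ m → m * (1 + R ^ 2) ≤ ε ^ 2 →
      ContinuousOn w (Set.Ico 0 R) → w 0 = 0 →
      (∀ s ∈ Set.Ioo 0 R, HasDerivAt w (w' s) s) →
      ContinuousOn (fun s => s * w' s) (Set.Ico 0 R) →
      (∀ s ∈ Set.Ioo 0 R, HasDerivAt (fun s => s * w' s)
        (s * (4 * (1 - ε * w s) * Real.exp (-2 * w s + ε * w s ^ 2) + m * (1 - ε * w s))) s) →
      ∀ s ∈ Set.Ico 0 R, |w s - T0 s + ε * S0 s| ≤ C * ε ^ 2 * (1 + T0 s) := by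
  obtain ⟨c, hc0, hc⟩ := weight_decay hδ1
  set A := 30000 * Real.exp 77 with hA
  have hA0 : 0 < A := by positivity
  set C := 21 * Real.exp (A * c / (1 - δ)) with hC
  have hC0 : 0 < C := by positivity
  have hη : 0 < 1 - δ := by linarith
  refine ⟨C, hC0, min 1 (1 / (4 * C)), by positivity, ?_⟩
  intro ε hε0 hε R m w w' hRδ hm0 hm hw hw0 hwd hP hPd
  have hε1 : ε < 1 := hε.trans_le (min_le_left _ _)
  have hεC : 4 * C * ε < 1 := by
    have := hε.trans_le (min_le_right _ _)
    rw [lt_div_iff₀ (by positivity)] at this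
    linarith
  have hTmono : ∀ s ∈ Set.Ico 0 R, T0 s ≤ T0 R := by
    intro s hs
    refine Real.log_le_log (by positivity) ?_
    nlinarith [hs.1, hs.2]
  set E : ℝ → ℝ := fun s => w s - T0 s + ε * S0 s with hE
  set E' : ℝ → ℝ := fun s => w' s - 2 * s / (1 + s ^ 2) + ε * (fluxS0 s / s) with hE'
  set G : ℝ → ℝ := fun s => (4 * (1 - ε * w s) * Real.exp (-2 * w s + ε * w s ^ 2)
    - 4 * Real.exp (-2 * T0 s) * (1 + ε * (T0 s ^ 2 - T0 s + 2 * S0 s))) + m * (1 - ε * w s)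
    with hG
  have hIci : Set.Ico 0 R ⊆ Set.Ici 0 := Set.Ico_subset_Ici_self
  have hSc := continuousOn_S0.mono hIci
  have hTc := continuous_T0.continuousOn (s := Set.Ico 0 R)
  have hEc : ContinuousOn E (Set.Ico 0 R) := by fun_prop
  have hGc : ContinuousOn G (Set.Ico 0 R) := by fun_prop
  have hE0 : E 0 = 0 := by simp [hE, hw0, T0_zero, S0_zero]
  have hEd : ∀ s ∈ Set.Ioo 0 R, HasDerivAt E (E' s) s := fun s hs =>
    ((hwd s hs).sub (hasDerivAt_T0 s)).add ((hasDerivAt_S0 hs.1).const_mul ε)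
  have hflux0 : fluxS0 0 = 0 := by simp [fluxS0, T0_zero]
  have hPE : (fun s => s * E' s) = fun s => s * w' s - 2 * s ^ 2 / (1 + s ^ 2) + ε * fluxS0 s := by
    funext s
    rcases eq_or_ne s 0 with rfl | hs
    · simp [hflux0]
    · simp only [hE']; field_simp
  have hPEc : ContinuousOn (fun s => s * E' s) (Set.Ico 0 R) := by
    rw [hPE]
    refine (hP.sub (ContinuousOn.div (by fun_prop) (by fun_prop) fun s _ => by positivity)).add
      ((continuousOn_fluxS0.mono hIci).const_smul ε)
  have hPEd : ∀ s ∈ Set.Ioo 0 R, HasDerivAt (fun s => s * E' s) (s * G s) s := by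
    intro s hs
    rw [hPE]
    have hq : HasDerivAt (fun s : ℝ => 1 + s ^ 2) (2 * s) s := by
      simpa using (hasDerivAt_pow 2 s).const_add 1
    have hsq : HasDerivAt (fun s : ℝ => s ^ 2) (2 * s) s := by
      simpa using (hasDerivAt_pow 2 s)
    have hne : 1 + s ^ 2 ≠ 0 := by positivity
    have he : Real.exp (-2 * T0 s) = 1 / (1 + s ^ 2) ^ 2 := by
      rw [show -2 * T0 s = -(T0 s + T0 s) by ring, Real.exp_neg, Real.exp_add, exp_T0]
      field_simp
    refine (((hPd s hs).sub ((hsq.const_mul 2).div hq hne)).add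
      ((hasDerivAt_fluxS0 hs.1).const_mul ε)).congr_deriv ?_
    simp only [hG]
    rw [he]
    field_simp
    ring
  have hlin : ∀ R' ≤ R, (∀ s ∈ Set.Ioo 0 R', |E s| ≤ 1) →
      ∀ s ∈ Set.Ico 0 R', |E s| ≤ C * ε ^ 2 * (1 + T0 s) := by
    intro R' hR' hb s hs
    have hs1 : Set.Ico 0 R' ⊆ Set.Ico 0 R := Set.Ico_subset_Ico_right hR'
    have hs2 : Set.Ioo 0 R' ⊆ Set.Ioo 0 R := Set.Ioo_subset_Ioo_right hR'
    have h := gronwall_radial (R := R') (c := A * c) (η := 1 - δ) (a := ε ^ 2) (b := 10 * m)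
      hη (by positivity) (by positivity) (by positivity) (hEc.mono hs1) hE0
      (fun s hs => hEd s (hs2 hs)) (hPEc.mono hs1) (fun s hs => hPEd s (hs2 hs)) (hGc.mono hs1) ?_
      s hs
    · refine h.trans ?_
      have h1 : (1 + s) ^ 2 ≤ 2 * (1 + R ^ 2) := by
        have := one_add_sq_le s
        have := (hs1 hs).2
        nlinarith [hs.1]
      have h2 : 10 * m * (1 + s) ^ 2 ≤ 20 * ε ^ 2 := by
        have := mul_le_mul_of_nonneg_left h1 hm0
        linarith
      calc (1 + T0 s) * (Real.exp (A * c / (1 - δ)) * (ε ^ 2 + 10 * m * (1 + s) ^ 2))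
          ≤ (1 + T0 s) * (Real.exp (A * c / (1 - δ)) * (ε ^ 2 + 20 * ε ^ 2)) := by
            have := T0_nonneg s
            gcongr
        _ = _ := by rw [hC]; ring
    · intro t ht
      have htT := T0_nonneg t
      have htR := hs2 ht
      have ht0 := ht.1
      obtain ⟨hb1, hb2⟩ := bubble_taylor (δ := δ) (ε := ε) (T := T0 t) (S := S0 t) (E := E t)
        (w := w t) hδ1 hε0 hε1.le htT
        ((mul_le_mul_of_nonneg_left (hTmono t ⟨htR.1.le, htR.2⟩) hε0.le).trans hRδ)
        (abs_S0_le ht0.le) (hb t ht) (by simp only [hE]; ring)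
      have hGt : |G t| ≤ A * Real.exp (-(2 - δ) * T0 t) * (|E t| + ε ^ 2 * (1 + T0 t) ^ 4)
          + 10 * m := by
        refine (abs_add_le _ _).trans (add_le_add hb1 ?_)
        rw [abs_mul, abs_of_nonneg hm0]
        nlinarith
      have h3 : |E t| + ε ^ 2 * (1 + T0 t) ^ 4 ≤
          (1 + T0 t) ^ 4 * (|E t| / (1 + T0 t) + ε ^ 2) := by
        have h4 : |E t| ≤ (1 + T0 t) ^ 4 * (|E t| / (1 + T0 t)) := by
          calc |E t| ≤ (1 + T0 t) ^ 3 * |E t| :=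
                le_mul_of_one_le_left (abs_nonneg _) (one_le_pow₀ (by linarith))
            _ = _ := by field_simp
        linarith
      have hY : 0 ≤ |E t| / (1 + T0 t) + ε ^ 2 := by positivity
      calc (1 + t) * |G t| ≤ (1 + t) * (A * Real.exp (-(2 - δ) * T0 t) *
            ((1 + T0 t) ^ 4 * (|E t| / (1 + T0 t) + ε ^ 2)) + 10 * m) := by
            refine mul_le_mul_of_nonneg_left (hGt.trans ?_) (by linarith)
            gcongr
        _ = A * ((1 + t) * Real.exp (-(2 - δ) * T0 t) * (1 + T0 t) ^ 4) *
            (|E t| / (1 + T0 t) + ε ^ 2) + 10 * m * (1 + t) := by ring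
        _ ≤ A * (c * (1 + t) ^ (-(1 + (1 - δ)))) *
            (|E t| / (1 + T0 t) + ε ^ 2) + 10 * m * (1 + t) := by
            have := mul_le_mul_of_nonneg_right
              (mul_le_mul_of_nonneg_left (hc t ht0.le) hA0.le) hY
            linarith
        _ = _ := by ring
  have hhalf : ∀ s ∈ Set.Ico 0 R, |E s| ≤ C * ε ^ 2 * (1 + T0 s) → |E s| ≤ 1 / 2 := by
    intro s hs h
    refine h.trans ?_
    have h1 : ε * (1 + T0 s) ≤ 2 := by
      have := mul_le_mul_of_nonneg_left (hTmono s hs) hε0.le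
      linarith
    calc C * ε ^ 2 * (1 + T0 s) = C * ε * (ε * (1 + T0 s)) := by ring
      _ ≤ C * ε * 2 := by gcongr
      _ ≤ _ := by linarith
  refine hlin R le_rfl ?_
  by_contra! hcon
  obtain ⟨s₁, hs₁, hbig⟩ := hcon
  -- the first time `|E| = 3/4` contradicts the improved bound
  have hsub : Set.Icc 0 s₁ ⊆ Set.Ico 0 R := fun t ht => ⟨ht.1, ht.2.trans_lt hs₁.2⟩
  set Z : Set ℝ := {t ∈ Set.Icc 0 s₁ | 3 / 4 ≤ |E t|} with hZ
  have hZc : IsCompact Z := by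
    have := (hEc.mono hsub).abs.preimage_isClosed_of_isClosed isClosed_Icc
      (isClosed_Ici (a := (3 / 4 : ℝ)))
    exact isCompact_Icc.of_isClosed_subset this Set.inter_subset_left
  have hZne : Z.Nonempty := ⟨s₁, Set.right_mem_Icc.2 hs₁.1.le, by linarith⟩
  obtain ⟨s₂, hs₂, hmin⟩ := hZc.exists_isLeast hZne
  have hs₂0 : 0 < s₂ := by
    rcases hs₂.1.1.eq_or_lt with h | h
    · have := hs₂.2
      rw [← h, hE0] at this
      norm_num at this
    · exact h
  have hs₂R := (hsub hs₂.1).2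
  have hlow : ∀ t ∈ Set.Ico 0 s₂, |E t| ≤ 1 / 2 := by
    intro t ht
    refine hhalf t ⟨ht.1, ht.2.trans hs₂R⟩ (hlin s₂ hs₂R.le ?_ t ht)
    intro u hu
    by_contra! h
    have := hmin (show u ∈ Z from ⟨⟨hu.1.le, hu.2.le.trans hs₂.1.2⟩, by linarith⟩)
    linarith [hu.2]
  have hcl : |E s₂| ≤ 1 / 2 := by
    have hcw : ContinuousWithinAt (fun t => |E t|) (Set.Ico 0 s₂) s₂ :=
      ((hEc s₂ ⟨hs₂0.le, hs₂R⟩).mono (Set.Ico_subset_Ico_right hs₂R.le)).abs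
    have hmem : s₂ ∈ closure (Set.Ico 0 s₂) := by
      rw [closure_Ico hs₂0.ne]; exact Set.right_mem_Icc.2 hs₂0.le
    have := mem_closure_iff_nhdsWithin_neBot.1 hmem
    exact le_of_tendsto hcw (eventually_mem_nhdsWithin.mono hlow)
  linarith [hs₂.2]

/-- The unit vector of angle `θ`. -/
def dirU (θ : ℝ) : E2 :=
  Real.cos θ • EuclideanSpace.single 0 (1 : ℝ) + Real.sin θ • EuclideanSpace.single 1 (1 : ℝ)

/-- The unit vector orthogonal to `dirU θ`. -/
def dirV (θ : ℝ) : E2 :=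
  (-Real.sin θ) • EuclideanSpace.single 0 (1 : ℝ) + Real.cos θ • EuclideanSpace.single 1 (1 : ℝ)

theorem hasDerivAt_dirU (θ : ℝ) : HasDerivAt dirU (dirV θ) θ :=
  ((Real.hasDerivAt_cos θ).smul_const _).add ((Real.hasDerivAt_sin θ).smul_const _)

theorem hasDerivAt_dirV (θ : ℝ) : HasDerivAt dirV (-dirU θ) θ := by
  refine (((Real.hasDerivAt_sin θ).neg.smul_const _).add
    ((Real.hasDerivAt_cos θ).smul_const _)).congr_deriv ?_
  simp [dirU, neg_smul, add_comm]

theorem continuous_dirU : Continuous dirU := by unfold dirU; fun_prop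

theorem continuous_dirV : Continuous dirV := by unfold dirV; fun_prop

theorem norm_dirU (θ : ℝ) : ‖dirU θ‖ = 1 := by
  rw [EuclideanSpace.norm_eq]
  simp [dirU]

theorem fderiv_fderiv_dirU_add_dirV (f : E2 → ℝ) (y : E2) (θ : ℝ) :
    fderiv ℝ (fderiv ℝ f) y (dirU θ) (dirU θ) + fderiv ℝ (fderiv ℝ f) y (dirV θ) (dirV θ) =
      -lapl f y := by
  simp only [lapl, Fin.sum_univ_two, iteratedFDeriv_two_apply, neg_neg, dirU, dirV, map_add,
    map_smul, add_apply, smul_apply, smul_eq_mul,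
    Matrix.cons_val_zero, Matrix.cons_val_one]
  linear_combination (fderiv ℝ (fderiv ℝ f) y (EuclideanSpace.single 0 1)
    (EuclideanSpace.single 0 1) + fderiv ℝ (fderiv ℝ f) y (EuclideanSpace.single 1 1)
    (EuclideanSpace.single 1 1)) * Real.sin_sq_add_cos_sq θ

section Polar

variable {f : E2 → ℝ} {x : E2}

theorem hasDerivAt_along {c : ℝ → E2} {c' : E2} {t : ℝ} (hf : DifferentiableAt ℝ f (c t))
    (hc : HasDerivAt c c' t) : HasDerivAt (fun t => f (c t)) (fderiv ℝ f (c t) c') t :=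
  hf.hasFDerivAt.comp_hasDerivAt t hc

theorem hasDerivAt_fderiv_along {c w : ℝ → E2} {c' w' : E2} {t : ℝ}
    (hf : DifferentiableAt ℝ (fderiv ℝ f) (c t)) (hc : HasDerivAt c c' t)
    (hw : HasDerivAt w w' t) :
    HasDerivAt (fun t => fderiv ℝ f (c t) (w t))
      (fderiv ℝ (fderiv ℝ f) (c t) c' (w t) + fderiv ℝ f (c t) w') t := by
  have h : HasDerivAt (fun t => fderiv ℝ f (c t)) (fderiv ℝ (fderiv ℝ f) (c t) c') t :=
    hf.hasFDerivAt.comp_hasDerivAt t hc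
  exact h.clm_apply hw

theorem hasDerivAt_ray (x v : E2) (s : ℝ) : HasDerivAt (fun s : ℝ => x + s • v) v s := by
  simpa using ((hasDerivAt_id s).smul_const v).const_add x

theorem hasDerivAt_circle (x : E2) (s θ : ℝ) :
    HasDerivAt (fun θ => x + s • dirU θ) (s • dirV θ) θ :=
  ((hasDerivAt_dirU θ).const_smul s).const_add x

theorem hasDerivAt_radial {v : E2} {s : ℝ} (hf : DifferentiableAt ℝ f (x + s • v)) :
    HasDerivAt (fun s => f (x + s • v)) (fderiv ℝ f (x + s • v) v) s :=
  hasDerivAt_along (c := fun s => x + s • v) hf (hasDerivAt_ray x v s)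

theorem hasDerivAt_fderiv_radial {v : E2} {s : ℝ}
    (hf : DifferentiableAt ℝ (fderiv ℝ f) (x + s • v)) :
    HasDerivAt (fun s => fderiv ℝ f (x + s • v) v)
      (fderiv ℝ (fderiv ℝ f) (x + s • v) v v) s := by
  have h := hasDerivAt_fderiv_along (c := fun s => x + s • v) (w := fun _ => v) hf
    (hasDerivAt_ray x v s) (hasDerivAt_const s v)
  rwa [map_zero, add_zero] at h

theorem hasDerivAt_angular {s θ : ℝ} (hf : DifferentiableAt ℝ f (x + s • dirU θ)) :
    HasDerivAt (fun θ => f (x + s • dirU θ)) (s * fderiv ℝ f (x + s • dirU θ) (dirV θ)) θ := by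
  have h := hasDerivAt_along (c := fun θ => x + s • dirU θ) hf (hasDerivAt_circle x s θ)
  rwa [map_smul, smul_eq_mul] at h

theorem hasDerivAt_fderiv_angular {s θ : ℝ}
    (hf : DifferentiableAt ℝ (fderiv ℝ f) (x + s • dirU θ)) :
    HasDerivAt (fun θ => fderiv ℝ f (x + s • dirU θ) (dirV θ))
      (s * fderiv ℝ (fderiv ℝ f) (x + s • dirU θ) (dirV θ) (dirV θ)
        - fderiv ℝ f (x + s • dirU θ) (dirU θ)) θ := by
  have h := hasDerivAt_fderiv_along (c := fun θ => x + s • dirU θ) (w := dirV) hf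
    (hasDerivAt_circle x s θ) (hasDerivAt_dirV θ)
  rwa [map_smul, smul_apply, smul_eq_mul, map_neg, ← sub_eq_add_neg] at h

theorem hasDerivAt_integral_param {F F' : ℝ → ℝ → ℝ} (hF : Continuous (Function.uncurry F))
    (hF' : Continuous (Function.uncurry F'))
    (hd : ∀ s θ, HasDerivAt (fun s => F s θ) (F' s θ) s) (a b s : ℝ) :
    HasDerivAt (fun s => ∫ θ in a..b, F s θ) (∫ θ in a..b, F' s θ) s := by
  obtain ⟨M, hM⟩ := ((isCompact_Icc (a := s - 1) (b := s + 1)).prod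
    (isCompact_uIcc (a := a) (b := b))).exists_bound_of_continuousOn hF'.continuousOn
  refine (intervalIntegral.hasDerivAt_integral_of_dominated_loc_of_deriv_le (F' := F')
    (bound := fun _ => M) (s := Set.Icc (s - 1) (s + 1))
    (Icc_mem_nhds (by linarith) (by linarith)) ?_ ?_ ?_ ?_ ?_ ?_).2
  · exact Filter.Eventually.of_forall fun t =>
      (hF.comp (by fun_prop : Continuous fun θ => (t, θ))).aestronglyMeasurable
  · exact (hF.comp (by fun_prop : Continuous fun θ => (s, θ))).intervalIntegrable a b
  · exact (hF'.comp (by fun_prop : Continuous fun θ => (s, θ))).aestronglyMeasurable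
  · exact Filter.Eventually.of_forall fun θ hθ t ht => hM (t, θ) ⟨ht, Set.uIoc_subset_uIcc hθ⟩
  · exact intervalIntegrable_const
  · exact Filter.Eventually.of_forall fun θ _ t _ => hd t θ

theorem continuous_polar_point (x : E2) :
    Continuous fun p : ℝ × ℝ => x + p.1 • dirU p.2 := by
  have := continuous_dirU
  fun_prop

theorem hasDerivAt_circleIntegral_radial (hf : ContDiff ℝ 2 f) (s : ℝ) :
    HasDerivAt (fun s => ∫ θ in (-Real.pi)..Real.pi, f (x + s • dirU θ))
      (∫ θ in (-Real.pi)..Real.pi, fderiv ℝ f (x + s • dirU θ) (dirU θ)) s := by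
  have hp := continuous_polar_point x
  have hU : Continuous fun p : ℝ × ℝ => dirU p.2 := continuous_dirU.comp continuous_snd
  have h1 : Continuous (fderiv ℝ f) := hf.continuous_fderiv (by norm_num)
  refine hasDerivAt_integral_param (F := fun s θ => f (x + s • dirU θ))
    (F' := fun s θ => fderiv ℝ f (x + s • dirU θ) (dirU θ)) (hf.continuous.comp hp)
    ((h1.comp hp).clm_apply hU) (fun s θ => ?_) _ _ s
  exact hasDerivAt_radial (hf.differentiable (by norm_num) _)

theorem hasDerivAt_flux (hf : ContDiff ℝ 2 f) (s : ℝ) :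
    HasDerivAt (fun s => ∫ θ in (-Real.pi)..Real.pi, s * fderiv ℝ f (x + s • dirU θ) (dirU θ))
      (∫ θ in (-Real.pi)..Real.pi, -(s * lapl f (x + s • dirU θ))) s := by
  have hp := continuous_polar_point x
  have hU : Continuous fun p : ℝ × ℝ => dirU p.2 := continuous_dirU.comp continuous_snd
  have hf1 : ContDiff ℝ 1 (fderiv ℝ f) := hf.fderiv_right (by norm_num)
  have h1 : Continuous (fderiv ℝ f) := hf1.continuous
  have h2 : Continuous (fderiv ℝ (fderiv ℝ f)) := hf1.continuous_fderiv (by norm_num)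
  have hd1 := hf1.differentiable (by norm_num)
  have hcD : Continuous fun p : ℝ × ℝ => fderiv ℝ f (x + p.1 • dirU p.2) (dirU p.2) :=
    (h1.comp hp).clm_apply hU
  have hcDD : Continuous fun p : ℝ × ℝ =>
      fderiv ℝ (fderiv ℝ f) (x + p.1 • dirU p.2) (dirU p.2) (dirU p.2) :=
    ((h2.comp hp).clm_apply hU).clm_apply hU
  have hF : Continuous (Function.uncurry
      fun s θ => s * fderiv ℝ f (x + s • dirU θ) (dirU θ)) := continuous_fst.mul hcD
  have hF' : Continuous (Function.uncurry fun s θ => 1 * fderiv ℝ f (x + s • dirU θ) (dirU θ)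
      + s * fderiv ℝ (fderiv ℝ f) (x + s • dirU θ) (dirU θ) (dirU θ)) :=
    (continuous_const.mul hcD).add (continuous_fst.mul hcDD)
  have key := hasDerivAt_integral_param hF hF'
    (fun s θ => (hasDerivAt_id s).mul (hasDerivAt_fderiv_radial (hd1 _))) (-Real.pi) Real.pi s
  refine key.congr_deriv ?_
  have hq : Continuous fun θ : ℝ => x + s • dirU θ :=
    continuous_const.add (continuous_dirU.const_smul s)
  have hc1 : Continuous fun θ => fderiv ℝ f (x + s • dirU θ) (dirU θ) :=
    (h1.comp hq).clm_apply continuous_dirU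
  have hc3 : Continuous fun θ => fderiv ℝ (fderiv ℝ f) (x + s • dirU θ) (dirV θ) (dirV θ) :=
    ((h2.comp hq).clm_apply continuous_dirV).clm_apply continuous_dirV
  have hc4 : Continuous fun θ => s * fderiv ℝ (fderiv ℝ f) (x + s • dirU θ) (dirV θ) (dirV θ)
        - fderiv ℝ f (x + s • dirU θ) (dirU θ) := (hc3.const_mul s).sub hc1
  have hc5 : Continuous fun θ => 1 * fderiv ℝ f (x + s • dirU θ) (dirU θ)
      + s * fderiv ℝ (fderiv ℝ f) (x + s • dirU θ) (dirU θ) (dirU θ) :=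
    hF'.comp (Continuous.prodMk continuous_const continuous_id)
  have h0 : ∫ θ in (-Real.pi)..Real.pi,
      (s * fderiv ℝ (fderiv ℝ f) (x + s • dirU θ) (dirV θ) (dirV θ)
        - fderiv ℝ f (x + s • dirU θ) (dirU θ)) = 0 := by
    rw [intervalIntegral.integral_eq_sub_of_hasDerivAt
      (fun θ _ => hasDerivAt_fderiv_angular (hd1 _)) (hc4.intervalIntegrable _ _)]
    simp [dirU, dirV]
  calc _ = (∫ θ in (-Real.pi)..Real.pi, (1 * fderiv ℝ f (x + s • dirU θ) (dirU θ)
      + s * fderiv ℝ (fderiv ℝ f) (x + s • dirU θ) (dirU θ) (dirU θ)))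
      + ∫ θ in (-Real.pi)..Real.pi,
      (s * fderiv ℝ (fderiv ℝ f) (x + s • dirU θ) (dirV θ) (dirV θ)
        - fderiv ℝ f (x + s • dirU θ) (dirU θ)) := by rw [h0, add_zero]
    _ = _ := by
      rw [← intervalIntegral.integral_add (hc5.intervalIntegrable _ _)
        (hc4.intervalIntegrable _ _)]
      refine intervalIntegral.integral_congr fun θ _ => ?_
      have := fderiv_fderiv_dirU_add_dirV f (x + s • dirU θ) θ
      linear_combination s * this

end Polar

theorem continuous_lapl {f : E2 → ℝ} (hf : ContDiff ℝ 2 f) : Continuous (lapl f) := by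
  have hf1 : ContDiff ℝ 1 (fderiv ℝ f) := hf.fderiv_right (by norm_num)
  have h2 : Continuous (fderiv ℝ (fderiv ℝ f)) := hf1.continuous_fderiv (by norm_num)
  have h : lapl f = fun y => -(fderiv ℝ (fderiv ℝ f) y (dirU 0) (dirU 0)
      + fderiv ℝ (fderiv ℝ f) y (dirV 0) (dirV 0)) := by
    funext y
    rw [fderiv_fderiv_dirU_add_dirV, neg_neg]
  rw [h]
  exact (((h2.clm_apply continuous_const).clm_apply continuous_const).add
    ((h2.clm_apply continuous_const).clm_apply continuous_const)).neg

/-- If `lapl f ≤ K`, circle integrals of `f` are at least `2πf(x) - πKs²/2`. -/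
theorem circleIntegral_lower {f : E2 → ℝ} {x : E2} {K : ℝ} (hf : ContDiff ℝ 2 f)
    (hK : ∀ y, lapl f y ≤ K) {s : ℝ} (hs : 0 ≤ s) :
    2 * Real.pi * f x - Real.pi * K * s ^ 2 / 2 ≤
      ∫ θ in (-Real.pi)..Real.pi, f (x + s • dirU θ) := by
  have hpi := Real.pi_pos
  have hflux : ∀ t, 0 ≤ t → -(Real.pi * K * t ^ 2) ≤
      t * ∫ θ in (-Real.pi)..Real.pi, fderiv ℝ f (x + t • dirU θ) (dirU θ) := by
    intro t ht
    have hd : ∀ s, HasDerivAt (fun s => (∫ θ in (-Real.pi)..Real.pi,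
        s * fderiv ℝ f (x + s • dirU θ) (dirU θ)) + Real.pi * K * s ^ 2)
        ((∫ θ in (-Real.pi)..Real.pi, -(s * lapl f (x + s • dirU θ)))
          + Real.pi * K * (2 * s)) s := fun s =>
      (hasDerivAt_flux hf s).add (((hasDerivAt_pow 2 s).congr_deriv (by simp)).const_mul _)
    have h := le_of_hasDerivAt_nonneg ht
      (fun s _ => (hd s).continuousAt.continuousWithinAt) (fun s _ => hd s) ?_
    · simp only [zero_mul, intervalIntegral.integral_zero, intervalIntegral.integral_const_mul] at h
      linarith
    · intro s hs
      have hq : Continuous fun θ : ℝ => x + s • dirU θ :=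
        continuous_const.add (continuous_dirU.const_smul s)
      have h1 : ∫ _ in (-Real.pi)..Real.pi, -(s * K) ≤
          ∫ θ in (-Real.pi)..Real.pi, -(s * lapl f (x + s • dirU θ)) := by
        refine intervalIntegral.integral_mono_on (by linarith) intervalIntegrable_const
          ((((continuous_lapl hf).comp hq).const_mul s).neg.intervalIntegrable _ _) fun θ _ => ?_
        exact neg_le_neg (mul_le_mul_of_nonneg_left (hK _) hs.1.le)
      rw [intervalIntegral.integral_const, smul_eq_mul] at h1
      linarith
  have hd : ∀ t, HasDerivAt (fun t => (∫ θ in (-Real.pi)..Real.pi, f (x + t • dirU θ))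
      + Real.pi * K / 2 * t ^ 2)
      ((∫ θ in (-Real.pi)..Real.pi, fderiv ℝ f (x + t • dirU θ) (dirU θ))
        + Real.pi * K / 2 * (2 * t)) t := fun t =>
    (hasDerivAt_circleIntegral_radial hf t).add
      (((hasDerivAt_pow 2 t).congr_deriv (by simp)).const_mul _)
  have h := le_of_hasDerivAt_nonneg hs
    (fun t _ => (hd t).continuousAt.continuousWithinAt) (fun t _ => hd t) ?_
  · simp only [zero_smul, add_zero, intervalIntegral.integral_const, smul_eq_mul] at h
    linarith
  · intro t ht
    have h1 := hflux t ht.1.le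
    refine nonneg_of_mul_nonneg_right (a := t) ?_ ht.1
    linarith

/-- The isometric parametrization of the plane by Cartesian coordinates centred at `x`
preserves the measure. -/
theorem measurePreserving_cartesian (x : E2) :
    MeasurePreserving (fun q : ℝ × ℝ =>
      x + (q.1 • EuclideanSpace.single 0 (1 : ℝ) + q.2 • EuclideanSpace.single 1 (1 : ℝ))) := by
  have h1 := (volume_preserving_finTwoArrow ℝ).symm
  have h2 := PiLp.volume_preserving_toLp (Fin 2)
  have h3 := measurePreserving_add_left (volume : Measure E2) x
  have h := h3.comp (h2.comp h1)
  have e : (fun q : ℝ × ℝ =>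
      x + (q.1 • EuclideanSpace.single 0 (1 : ℝ) + q.2 • EuclideanSpace.single 1 (1 : ℝ))) =
      (fun y => x + y) ∘ WithLp.toLp 2 ∘ ⇑MeasurableEquiv.finTwoArrow.symm := by
    funext q
    ext i
    fin_cases i <;> simp [MeasurableEquiv.finTwoArrow]
  rw [e]
  exact h

theorem polar_integral_le {G : E2 → ℝ} (hG : Continuous G) (hG0 : ∀ y, 0 ≤ G y)
    (hGi : Integrable G) (x : E2) {ρ D : ℝ} (hρ : 0 < ρ) (hρD : ρ ≤ D) :
    ∫ s in ρ..D, ∫ θ in (-Real.pi)..Real.pi, s * G (x + s • dirU θ) ≤ ∫ y, G y := by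
  have hpi := Real.pi_pos
  have hc : Continuous fun p : ℝ × ℝ => p.1 * G (x + p.1 • dirU p.2) :=
    continuous_fst.mul (hG.comp (continuous_polar_point x))
  have hint : IntegrableOn (fun p : ℝ × ℝ => p.1 * G (x + p.1 • dirU p.2))
      (Set.Ioc ρ D ×ˢ Set.Ioo (-Real.pi) Real.pi) :=
    (hc.continuousOn.integrableOn_compact (isCompact_Icc.prod isCompact_Icc)).mono_set
      (Set.prod_mono Set.Ioc_subset_Icc_self Set.Ioo_subset_Icc_self)
  have hS : MeasurableSet (Set.Ioc ρ D ×ˢ Set.Ioo (-Real.pi) Real.pi) :=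
    measurableSet_Ioc.prod measurableSet_Ioo
  have heq : ∫ s in ρ..D, ∫ θ in (-Real.pi)..Real.pi, s * G (x + s • dirU θ) =
      ∫ p in Set.Ioc ρ D ×ˢ Set.Ioo (-Real.pi) Real.pi, p.1 * G (x + p.1 • dirU p.2) := by
    rw [Measure.volume_eq_prod] at hint ⊢
    rw [setIntegral_prod _ hint, intervalIntegral.integral_of_le hρD]
    refine setIntegral_congr_fun measurableSet_Ioc fun s _ => ?_
    simp only []
    rw [intervalIntegral.integral_of_le (by linarith), integral_Ioc_eq_integral_Ioo]
  rw [heq, ← ENNReal.ofReal_le_ofReal_iff (integral_nonneg hG0),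
    ofReal_integral_eq_lintegral_ofReal hint, ofReal_integral_eq_lintegral_ofReal hGi
      (Filter.Eventually.of_forall hG0)]
  · have hmp := measurePreserving_cartesian x
    have hme : Measurable fun y => ENNReal.ofReal (G y) := hG.measurable.ennreal_ofReal
    rw [← hmp.lintegral_comp hme, ← lintegral_comp_polarCoord_symm]
    refine (lintegral_mono_set (μ := volume) (t := polarCoord.target) ?_).trans ?_
    · rintro ⟨s, θ⟩ ⟨h1, h2⟩
      exact ⟨hρ.trans h1.1, h2⟩
    · refine setLIntegral_mono' polarCoord.open_target.measurableSet fun p hp => ?_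
      have hp1 : 0 < p.1 := hp.1
      have : x + ((polarCoord.symm p).1 • EuclideanSpace.single 0 (1 : ℝ)
          + (polarCoord.symm p).2 • EuclideanSpace.single 1 (1 : ℝ)) = x + p.1 • dirU p.2 := by
        simp [dirU, smul_smul, polarCoord_symm_apply]
      rw [this, ENNReal.ofReal_mul hp1.le, smul_eq_mul]
  · filter_upwards [ae_restrict_mem hS] with p hp
    exact mul_nonneg (hρ.trans hp.1.1).le (hG0 _)

/-- Energy bound for circle integrals of a function vanishing on a large circle. -/
theorem circleIntegral_upper {f : E2 → ℝ} {x : E2} (hf : ContDiff ℝ 2 f) {ρ D lam : ℝ}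
    (hρ : 0 < ρ) (hρD : ρ ≤ D) (hlam : 0 < lam) (hD : ∀ θ, f (x + D • dirU θ) = 0)
    (hi : Integrable fun y => ‖fderiv ℝ f y‖ ^ 2) :
    ∫ θ in (-Real.pi)..Real.pi, f (x + ρ • dirU θ) ≤
      lam / 2 * (∫ y, ‖fderiv ℝ f y‖ ^ 2) + Real.pi / lam * Real.log (D / ρ) := by
  have hpi := Real.pi_pos
  have h1 : Continuous (fderiv ℝ f) := hf.continuous_fderiv (by norm_num)
  have hG : Continuous fun y => ‖fderiv ℝ f y‖ ^ 2 := h1.norm.pow 2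
  have hG2 : Continuous fun p : ℝ × ℝ => ‖fderiv ℝ f (x + p.1 • dirU p.2)‖ ^ 2 :=
    hG.comp (continuous_polar_point x)
  have hG3 : Continuous (Function.uncurry fun s θ => s * ‖fderiv ℝ f (x + s • dirU θ)‖ ^ 2) :=
    continuous_fst.mul hG2
  have hNc : Continuous fun s => ∫ θ in (-Real.pi)..Real.pi,
      s * ‖fderiv ℝ f (x + s • dirU θ)‖ ^ 2 :=
    intervalIntegral.continuous_parametric_intervalIntegral_of_continuous' hG3 _ _
  have hpol := polar_integral_le hG (fun y => sq_nonneg _) hi x hρ hρD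
  have hd : ∀ s ∈ Set.Ioo ρ D, HasDerivAt (fun s =>
      (∫ θ in (-Real.pi)..Real.pi, f (x + s • dirU θ))
        + lam / 2 * (∫ t in ρ..s, ∫ θ in (-Real.pi)..Real.pi,
          t * ‖fderiv ℝ f (x + t • dirU θ)‖ ^ 2) + Real.pi / lam * Real.log s)
      ((∫ θ in (-Real.pi)..Real.pi, fderiv ℝ f (x + s • dirU θ) (dirU θ))
        + lam / 2 * (∫ θ in (-Real.pi)..Real.pi, s * ‖fderiv ℝ f (x + s • dirU θ)‖ ^ 2)
        + Real.pi / lam * s⁻¹) s := by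
    intro s hs
    exact ((hasDerivAt_circleIntegral_radial hf s).add
      ((hNc.integral_hasStrictDerivAt ρ s).hasDerivAt.const_mul _)).add
      ((Real.hasDerivAt_log (hρ.trans hs.1).ne').const_mul _)
  have hcont : ContinuousOn (fun s =>
      (∫ θ in (-Real.pi)..Real.pi, f (x + s • dirU θ))
        + lam / 2 * (∫ t in ρ..s, ∫ θ in (-Real.pi)..Real.pi,
          t * ‖fderiv ℝ f (x + t • dirU θ)‖ ^ 2) + Real.pi / lam * Real.log s)
      (Set.Icc ρ D) := by
    intro s hs
    exact (((hasDerivAt_circleIntegral_radial hf s).add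
      ((hNc.integral_hasStrictDerivAt ρ s).hasDerivAt.const_mul _)).add
      ((Real.hasDerivAt_log (hρ.trans_le hs.1).ne').const_mul _)).continuousAt.continuousWithinAt
  have h := le_of_hasDerivAt_nonneg hρD hcont hd ?_
  · simp only [hD, intervalIntegral.integral_zero, intervalIntegral.integral_same] at h
    rw [Real.log_div (hρ.trans_le hρD).ne' hρ.ne']
    have := mul_le_mul_of_nonneg_left hpol (half_pos hlam).le
    linarith
  · intro s hs
    have hs0 : 0 < s := hρ.trans hs.1
    have hq : Continuous fun θ : ℝ => x + s • dirU θ :=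
      continuous_const.add (continuous_dirU.const_smul s)
    have hc1 : Continuous fun θ => fderiv ℝ f (x + s • dirU θ) (dirU θ) :=
      (h1.comp hq).clm_apply continuous_dirU
    have hc2 : Continuous fun θ => s * ‖fderiv ℝ f (x + s • dirU θ)‖ ^ 2 :=
      (hG.comp hq).const_mul s
    have hm : ∫ _ in (-Real.pi)..Real.pi, -(1 / (2 * lam * s)) ≤
        ∫ θ in (-Real.pi)..Real.pi, (fderiv ℝ f (x + s • dirU θ) (dirU θ)
          + lam / 2 * (s * ‖fderiv ℝ f (x + s • dirU θ)‖ ^ 2)) := by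
      refine intervalIntegral.integral_mono_on (by linarith) intervalIntegrable_const
        ((hc1.add (hc2.const_mul _)).intervalIntegrable _ _) fun θ _ => ?_
      have hle : -‖fderiv ℝ f (x + s • dirU θ)‖ ≤ fderiv ℝ f (x + s • dirU θ) (dirU θ) := by
        have := (fderiv ℝ f (x + s • dirU θ)).le_opNorm (dirU θ)
        rw [norm_dirU, mul_one, Real.norm_eq_abs] at this
        exact (abs_le.1 this).1
      have hsq : 0 ≤ (lam * s * ‖fderiv ℝ f (x + s • dirU θ)‖ - 1) ^ 2 / (2 * lam * s) := by
        positivity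
      have : (lam * s * ‖fderiv ℝ f (x + s • dirU θ)‖ - 1) ^ 2 / (2 * lam * s) =
          lam / 2 * (s * ‖fderiv ℝ f (x + s • dirU θ)‖ ^ 2) - ‖fderiv ℝ f (x + s • dirU θ)‖
            + 1 / (2 * lam * s) := by
        field_simp
        ring
      linarith
    rw [intervalIntegral.integral_const, smul_eq_mul, intervalIntegral.integral_add
      (hc1.intervalIntegrable _ _) ((hc2.const_mul _).intervalIntegrable _ _),
      intervalIntegral.integral_const_mul] at hm
    have : (Real.pi - -Real.pi) * -(1 / (2 * lam * s)) = -(Real.pi / lam * s⁻¹) := by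
      field_simp
      ring
    linarith

/-- A smooth convex truncation of the identity. -/
def softCut (s : ℝ) : ℝ := ∫ t in (0 : ℝ)..s, Real.smoothTransition (t - 1)

theorem hasDerivAt_softCut (s : ℝ) : HasDerivAt softCut (Real.smoothTransition (s - 1)) s := by
  have hc : Continuous fun t : ℝ => Real.smoothTransition (t - 1) :=
    Real.smoothTransition.continuous.comp (continuous_id.sub continuous_const)
  exact (hc.integral_hasStrictDerivAt 0 s).hasDerivAt

theorem contDiff_softCut : ContDiff ℝ 2 softCut := by
  have hd : deriv softCut = fun s => Real.smoothTransition (s - 1) :=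
    funext fun s => (hasDerivAt_softCut s).deriv
  have h : ContDiff ℝ (1 + 1) softCut := by
    refine contDiff_succ_iff_deriv.2 ⟨fun s => (hasDerivAt_softCut s).differentiableAt,
      by simp, ?_⟩
    rw [hd]
    exact Real.smoothTransition.contDiff.comp (contDiff_id.sub contDiff_const)
  exact h

theorem softCut_eq_zero {s : ℝ} (hs0 : 0 ≤ s) (hs : s ≤ 1) : softCut s = 0 := by
  refine intervalIntegral.integral_zero_ae (Filter.Eventually.of_forall fun t ht => ?_)
  rw [Set.uIoc_of_le hs0] at ht
  exact Real.smoothTransition.zero_of_nonpos (by linarith [ht.2])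

theorem softCut_nonneg {s : ℝ} (hs : 0 ≤ s) : 0 ≤ softCut s :=
  intervalIntegral.integral_nonneg hs fun _ _ => Real.smoothTransition.nonneg _

theorem sub_two_le_softCut {s : ℝ} (hs : 0 ≤ s) : s - 2 ≤ softCut s := by
  rcases le_total s 2 with h | h
  · linarith [softCut_nonneg hs]
  · have hd : ∀ t, HasDerivAt (fun t => softCut t - t) (Real.smoothTransition (t - 1) - 1) t :=
      fun t => (hasDerivAt_softCut t).sub (hasDerivAt_id t)
    have := le_of_hasDerivAt_nonneg h (fun t _ => (hd t).continuousAt.continuousWithinAt)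
      (fun t _ => hd t) fun t ht => by
        rw [Real.smoothTransition.one_of_one_le (by linarith [ht.1]), sub_self]
    linarith [softCut_nonneg (s := 2) (by norm_num)]

theorem exists_truncation {Ω : Set E2} (hΩo : IsOpen Ω) {v : E2 → ℝ} (hsm : ContDiffOn ℝ 2 v Ω)
    (hct : ContinuousOn v (closure Ω)) (hbd : ∀ y ∈ frontier Ω, v y = 0)
    (hpos : ∀ y ∈ Ω, 0 < v y) {K : ℝ} (hK0 : 0 ≤ K) (hK : ∀ y ∈ Ω, lapl v y ≤ K) :
    ∃ f : E2 → ℝ, ContDiff ℝ 2 f ∧ (∀ y, lapl f y ≤ K) ∧ (∀ y ∉ Ω, f y = 0) ∧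
      (∀ y ∈ Ω, v y - 2 ≤ f y) ∧ (∀ y ∈ Ω, ‖fderiv ℝ f y‖ ≤ ‖gradient v y‖) ∧
      ∀ y ∉ Ω, fderiv ℝ f y = 0 := by
  classical
  set f : E2 → ℝ := fun y => if y ∈ Ω then softCut (v y) else 0 with hf
  have hout : ∀ y ∉ Ω, f =ᶠ[𝓝 y] fun _ => 0 := by
    intro y hy
    have h1 : ∀ᶠ z in 𝓝 y, z ∈ Ω → v z < 1 := by
      by_cases hc : y ∈ closure Ω
      · have hv : v y = 0 := hbd y (by rw [hΩo.frontier_eq]; exact ⟨hc, hy⟩)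
        have := (hct y hc).eventually (gt_mem_nhds (by rw [hv]; norm_num : v y < 1))
        rw [eventually_nhdsWithin_iff] at this
        filter_upwards [this] with z hz hzΩ using hz (subset_closure hzΩ)
      · filter_upwards [isClosed_closure.isOpen_compl.mem_nhds hc] with z hz hzΩ
        exact absurd (subset_closure hzΩ) hz
    filter_upwards [h1] with z hz
    by_cases hzΩ : z ∈ Ω
    · simp only [hf, if_pos hzΩ]
      exact softCut_eq_zero (hpos z hzΩ).le (hz hzΩ).le
    · simp only [hf, if_neg hzΩ]
  have hin : ∀ y ∈ Ω, f =ᶠ[𝓝 y] fun z => softCut (v z) := by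
    intro y hy
    filter_upwards [hΩo.mem_nhds hy] with z hz
    simp only [hf, if_pos hz]
  have hva : ∀ y ∈ Ω, ContDiffAt ℝ 2 v y := fun y hy => hsm.contDiffAt (hΩo.mem_nhds hy)
  have hfd : ∀ y ∈ Ω, fderiv ℝ f y = Real.smoothTransition (v y - 1) • fderiv ℝ v y := by
    intro y hy
    rw [(hin y hy).fderiv_eq]
    have hv : HasFDerivAt v (fderiv ℝ v y) y :=
      ((hva y hy).differentiableAt (by norm_num)).hasFDerivAt
    exact ((hasDerivAt_softCut (v y)).comp_hasFDerivAt y hv).fderiv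
  have hlap0 : ∀ y, lapl f y = -(fderiv ℝ (fderiv ℝ f) y (dirU 0) (dirU 0)
      + fderiv ℝ (fderiv ℝ f) y (dirV 0) (dirV 0)) := fun y => by
    rw [fderiv_fderiv_dirU_add_dirV, neg_neg]
  refine ⟨f, ?_, ?_, ?_, ?_, ?_, ?_⟩
  · refine contDiff_iff_contDiffAt.2 fun y => ?_
    by_cases hy : y ∈ Ω
    · exact (contDiff_softCut.contDiffAt.comp y (hva y hy)).congr_of_eventuallyEq (hin y hy)
    · exact contDiffAt_const.congr_of_eventuallyEq (hout y hy)
  · intro y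
    rw [hlap0]
    by_cases hy : y ∈ Ω
    · have heq : fderiv ℝ f =ᶠ[𝓝 y]
          fun z => Real.smoothTransition (v z - 1) • fderiv ℝ v z := by
        filter_upwards [hΩo.mem_nhds hy] with z hz using hfd z hz
      have hv : HasFDerivAt v (fderiv ℝ v y) y :=
        ((hva y hy).differentiableAt (by norm_num)).hasFDerivAt
      have hdv : HasFDerivAt (fderiv ℝ v) (fderiv ℝ (fderiv ℝ v) y) y :=
        (((hva y hy).fderiv_right (m := 1) (by norm_num)).differentiableAt
          (by norm_num)).hasFDerivAt
      have hφc : ContDiff ℝ 1 fun s : ℝ => Real.smoothTransition (s - 1) :=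
        Real.smoothTransition.contDiff.comp (contDiff_id.sub contDiff_const)
      have hφ : HasDerivAt (fun s : ℝ => Real.smoothTransition (s - 1))
          (deriv (fun s : ℝ => Real.smoothTransition (s - 1)) (v y)) (v y) :=
        (hφc.differentiable (by norm_num) _).hasDerivAt
      have hφ0 : 0 ≤ deriv (fun s : ℝ => Real.smoothTransition (s - 1)) (v y) := by
        have hm : Monotone fun s : ℝ => Real.smoothTransition (s - 1) := fun a b hab =>
          Real.smoothTransition.monotone (by linarith)
        exact hm.deriv_nonneg
      have hcv : HasFDerivAt (fun z => Real.smoothTransition (v z - 1))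
          (deriv (fun s : ℝ => Real.smoothTransition (s - 1)) (v y) • fderiv ℝ v y) y :=
        hφ.comp_hasFDerivAt y hv
      have hD2 := (hcv.fun_smul hdv).fderiv
      have hlv := fderiv_fderiv_dirU_add_dirV v y 0
      rw [heq.fderiv_eq, hD2]
      simp only [add_apply, smul_apply, ContinuousLinearMap.smulRight_apply, smul_eq_mul]
      set φ' := deriv (fun s : ℝ => Real.smoothTransition (s - 1)) (v y)
      have h1 : 0 ≤ φ' * fderiv ℝ v y (dirU 0) ^ 2 := mul_nonneg hφ0 (sq_nonneg _)
      have h2 : 0 ≤ φ' * fderiv ℝ v y (dirV 0) ^ 2 := mul_nonneg hφ0 (sq_nonneg _)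
      have h3 := mul_le_mul_of_nonneg_left (hK y hy) (Real.smoothTransition.nonneg (v y - 1))
      have h4 := mul_le_mul_of_nonneg_right (Real.smoothTransition.le_one (v y - 1)) hK0
      have h5 : Real.smoothTransition (v y - 1) * lapl v y =
          -(Real.smoothTransition (v y - 1) * (fderiv ℝ (fderiv ℝ v) y (dirU 0) (dirU 0)
            + fderiv ℝ (fderiv ℝ v) y (dirV 0) (dirV 0))) := by rw [hlv]; ring
      linarith
    · have : fderiv ℝ f =ᶠ[𝓝 y] fun _ => 0 := by
        filter_upwards [(hout y hy).eventuallyEq_nhds] with z hz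
        rw [hz.fderiv_eq, fderiv_fun_const]
        rfl
      rw [this.fderiv_eq]
      simpa using hK0
  · intro y hy
    exact (hout y hy).self_of_nhds
  · intro y hy
    simp only [hf, if_pos hy]
    exact sub_two_le_softCut (hpos y hy).le
  · intro y hy
    rw [hfd y hy, norm_smul, Real.norm_eq_abs, abs_of_nonneg (Real.smoothTransition.nonneg _),
      gradient, LinearIsometryEquiv.norm_map]
    exact mul_le_of_le_one_left (norm_nonneg _) (Real.smoothTransition.le_one _)
  · intro y hy
    rw [(hout y hy).fderiv_eq, fderiv_fun_const]
    rfl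

/-- Quantitative bound for the height of a function with bounded Laplacian in terms of its
Dirichlet energy. -/
theorem peak_le {Ω : Set E2} (hΩo : IsOpen Ω) {v : E2 → ℝ} (hsm : ContDiffOn ℝ 2 v Ω)
    (hct : ContinuousOn v (closure Ω)) (hbd : ∀ y ∈ frontier Ω, v y = 0)
    (hpos : ∀ y ∈ Ω, 0 < v y) {K : ℝ} (hK0 : 0 ≤ K) (hK : ∀ y ∈ Ω, lapl v y ≤ K)
    (hi : IntegrableOn (fun y => ‖gradient v y‖ ^ 2) Ω) {x : E2} (hx : x ∈ Ω) {ρ D lam : ℝ}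
    (hD : ∀ y ∈ Ω, dist y x < D) (hρ : 0 < ρ) (hρD : ρ ≤ D) (hlam : 0 < lam) :
    2 * Real.pi * (v x - 2) - Real.pi * K * ρ ^ 2 / 2 ≤
      lam / 2 * (∫ y in Ω, ‖gradient v y‖ ^ 2) + Real.pi / lam * Real.log (D / ρ) := by
  obtain ⟨f, hf, hfK, hf0, hfv, hfg, hfg0⟩ := exists_truncation hΩo hsm hct hbd hpos hK0 hK
  have hc : Continuous fun y => ‖fderiv ℝ f y‖ ^ 2 :=
    (hf.continuous_fderiv (by norm_num)).norm.pow 2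
  have hle : ∀ y ∈ Ω, ‖fderiv ℝ f y‖ ^ 2 ≤ ‖gradient v y‖ ^ 2 := fun y hy =>
    pow_le_pow_left₀ (norm_nonneg _) (hfg y hy) 2
  have hzero : ∀ y ∉ Ω, ‖fderiv ℝ f y‖ ^ 2 = 0 := fun y hy => by
    rw [hfg0 y hy, norm_zero]
    norm_num
  have hiΩ : IntegrableOn (fun y => ‖fderiv ℝ f y‖ ^ 2) Ω := by
    refine Integrable.mono' hi hc.aestronglyMeasurable ?_
    filter_upwards [ae_restrict_mem hΩo.measurableSet] with y hy
    rw [Real.norm_eq_abs, abs_of_nonneg (sq_nonneg _)]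
    exact hle y hy
  have hif : Integrable fun y => ‖fderiv ℝ f y‖ ^ 2 := by
    refine (integrableOn_iff_integrable_of_support_subset fun y hy => ?_).1 hiΩ
    by_contra h
    exact hy (hzero y h)
  have hen : ∫ y, ‖fderiv ℝ f y‖ ^ 2 ≤ ∫ y in Ω, ‖gradient v y‖ ^ 2 := by
    rw [← setIntegral_eq_integral_of_forall_compl_eq_zero hzero]
    exact setIntegral_mono_on hiΩ hi hΩo.measurableSet hle
  have hcirc : ∀ θ, f (x + D • dirU θ) = 0 := by
    intro θ
    refine hf0 _ fun h => ?_
    have h1 := hD _ h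
    rw [dist_eq_norm, add_sub_cancel_left, norm_smul, norm_dirU, mul_one, Real.norm_eq_abs] at h1
    exact absurd (le_abs_self D) (not_le.2 h1)
  have h1 := circleIntegral_lower (x := x) hf hfK hρ.le
  have h2 := circleIntegral_upper hf hρ hρD hlam hcirc hif
  have h3 := mul_le_mul_of_nonneg_left hen (half_pos hlam).le
  have h4 := mul_le_mul_of_nonneg_left (hfv x hx) Real.two_pi_pos.le
  linarith

/-- The nonlinear coefficient of a concentrating family with energy close to `4π` decays at most
like `exp (-κγ²)` for every `κ > 0`. -/
theorem eventually_exp_le {Ω : Set E2} (hΩo : IsOpen Ω) (hΩb : IsBounded Ω) {lam1 : ℝ}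
    (hlam1 : 0 < lam1) {v : ℕ → E2 → ℝ} {A L : ℕ → ℝ} {x : ℕ → E2}
    (hA : ∀ n, 0 ≤ A n ∧ A n < lam1) (hL : ∀ n, 0 < L n) (hsm : ∀ n, ContDiffOn ℝ 2 (v n) Ω)
    (hct : ∀ n, ContinuousOn (v n) (closure Ω)) (hpos : ∀ n, ∀ y ∈ Ω, 0 < v n y)
    (hpde : ∀ n, ∀ y ∈ Ω, lapl (v n) y = v n y * (A n + L n * Real.exp ((v n y) ^ 2)))
    (hbd : ∀ n, ∀ y ∈ frontier Ω, v n y = 0)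
    (hgint : ∀ n, IntegrableOn (fun y => ‖gradient (v n) y‖ ^ 2) Ω)
    (henergy : Tendsto (fun n => ∫ y in Ω, ‖gradient (v n) y‖ ^ 2) atTop (𝓝 (4 * Real.pi)))
    (hxΩ : ∀ n, x n ∈ Ω) (hmax : ∀ n, ∀ y ∈ Ω, v n y ≤ v n (x n))
    (hγ : Tendsto (fun n => v n (x n)) atTop atTop) {κ : ℝ} (hκ0 : 0 < κ) (hκ1 : κ < 1) :
    ∀ᶠ n in atTop, Real.exp (-(κ * (v n (x n)) ^ 2)) ≤ L n := by
  obtain ⟨D0, hD0⟩ := Metric.isBounded_iff.1 hΩb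
  have hpi := Real.pi_pos
  set D : ℝ := max D0 0 + 1 with hDdef
  have hD1 : 1 ≤ D := by linarith [le_max_right D0 0]
  have hDd : ∀ n, ∀ y ∈ Ω, dist y (x n) < D := fun n y hy => by
    linarith [hD0 hy (hxΩ n), le_max_left D0 0]
  have hlogD := Real.log_nonneg hD1
  have hE : ∀ᶠ n in atTop, ∫ y in Ω, ‖gradient (v n) y‖ ^ 2 < 4 * Real.pi * (1 + κ / 2) :=
    henergy.eventually (gt_mem_nhds (by nlinarith [mul_pos hpi hκ0]))
  filter_upwards [hE, hγ.eventually_ge_atTop 1,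
    hγ.eventually_gt_atTop (2 / κ * (11 / 2 + 2 * Real.log D + lam1))] with n hEn hγ1 hγbig
  by_contra hcon
  rw [not_le] at hcon
  set γ := v n (x n) with hγdef
  have hγ0 : 0 < γ := by linarith
  set K : ℝ := γ * ((lam1 + 1) * Real.exp ((1 - κ) * γ ^ 2)) with hKdef
  have hexp1 : 1 ≤ Real.exp ((1 - κ) * γ ^ 2) :=
    Real.one_le_exp (mul_nonneg (by linarith) (sq_nonneg _))
  have hKK : ∀ y ∈ Ω, lapl (v n) y ≤ K := by
    intro y hy
    rw [hpde n y hy]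
    have hv0 := hpos n y hy
    have hvγ : v n y ≤ γ := hmax n y hy
    have he : Real.exp ((v n y) ^ 2) ≤ Real.exp (γ ^ 2) :=
      Real.exp_le_exp.2 (pow_le_pow_left₀ hv0.le hvγ 2)
    have h1 : L n * Real.exp ((v n y) ^ 2) ≤ Real.exp ((1 - κ) * γ ^ 2) := by
      calc L n * Real.exp ((v n y) ^ 2) ≤ Real.exp (-(κ * γ ^ 2)) * Real.exp (γ ^ 2) :=
            mul_le_mul hcon.le he (Real.exp_pos _).le (Real.exp_pos _).le
        _ = Real.exp ((1 - κ) * γ ^ 2) := by rw [← Real.exp_add]; congr 1; ring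
    have h2 : A n ≤ lam1 * Real.exp ((1 - κ) * γ ^ 2) :=
      (hA n).2.le.trans (le_mul_of_one_le_right hlam1.le hexp1)
    refine mul_le_mul hvγ (by linarith) ?_ hγ0.le
    exact add_nonneg (hA n).1 (mul_nonneg (hL n).le (Real.exp_pos _).le)
  have hK1 : 1 ≤ K := by
    have : 1 ≤ (lam1 + 1) * Real.exp ((1 - κ) * γ ^ 2) :=
      one_le_mul_of_one_le_of_one_le (by linarith) hexp1
    exact one_le_mul_of_one_le_of_one_le hγ1 this
  have hK0 : 0 < K := by linarith
  set ρ : ℝ := Real.exp (-(Real.log K / 2)) with hρdef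
  have hρ0 : 0 < ρ := Real.exp_pos _
  have hρ1 : ρ ≤ 1 := Real.exp_le_one_iff.2 (by linarith [Real.log_nonneg hK1])
  have hKρ : K * ρ ^ 2 = 1 := by
    rw [hρdef, ← Real.exp_nat_mul]
    have : ((2 : ℕ) : ℝ) * -(Real.log K / 2) = -Real.log K := by push_cast; ring
    rw [this, Real.exp_neg, Real.exp_log hK0, mul_inv_cancel₀ hK0.ne']
  have hlogK : Real.log K ≤ γ * (lam1 + 1) + (1 - κ) * γ ^ 2 := by
    have : Real.log K = Real.log (γ * (lam1 + 1)) + (1 - κ) * γ ^ 2 := by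
      rw [hKdef, ← mul_assoc, Real.log_mul (by positivity) (Real.exp_pos _).ne', Real.log_exp]
    rw [this]
    linarith [Real.log_le_self (show 0 ≤ γ * (lam1 + 1) by positivity)]
  have hlogDρ : Real.log (D / ρ) = Real.log D + Real.log K / 2 := by
    rw [Real.log_div (by linarith) hρ0.ne', hρdef, Real.log_exp]
    ring
  have hpk := peak_le hΩo (hsm n) (hct n) (hbd n) (hpos n) hK0.le hKK (hgint n) (hxΩ n) (hDd n)
    hρ0 (hρ1.trans hD1) (half_pos hγ0)
  rw [← hγdef, hlogDρ, mul_assoc Real.pi K, hKρ] at hpk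
  have h1 : γ / 2 / 2 * (∫ y in Ω, ‖gradient (v n) y‖ ^ 2) ≤
      γ / 2 / 2 * (4 * Real.pi * (1 + κ / 2)) :=
    mul_le_mul_of_nonneg_left hEn.le (by positivity)
  have h2 : Real.pi / (γ / 2) * (Real.log D + Real.log K / 2) ≤
      Real.pi * (2 * Real.log D + (lam1 + 1) + (1 - κ) * γ) := by
    have h3 : Real.log D ≤ γ * Real.log D := le_mul_of_one_le_left hlogD hγ1
    have h4 : Real.pi / (γ / 2) * (Real.log D + Real.log K / 2) ≤
        Real.pi / (γ / 2) * (γ * Real.log D + (γ * (lam1 + 1) + (1 - κ) * γ ^ 2) / 2) :=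
      mul_le_mul_of_nonneg_left (by linarith) (by positivity)
    refine h4.trans (le_of_eq ?_)
    field_simp
    ring
  have h5 : Real.pi * (κ * γ / 2) ≤ Real.pi * (11 / 2 + 2 * Real.log D + lam1) := by
    linarith only [hpk, h1, h2]
  have h6 := le_of_mul_le_mul_left h5 hpi
  have h7 : κ * (2 / κ * (11 / 2 + 2 * Real.log D + lam1)) < κ * γ :=
    mul_lt_mul_of_pos_left hγbig hκ0
  have h8 : κ * (2 / κ * (11 / 2 + 2 * Real.log D + lam1)) =
      2 * (11 / 2 + 2 * Real.log D + lam1) := by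
    field_simp
  linarith

section Radial

variable {B : E2 → ℝ} {x : E2} {r : ℝ}

theorem dist_add_smul_dirU (x : E2) {s : ℝ} (hs : 0 ≤ s) (θ : ℝ) :
    dist (x + s • dirU θ) x = s := by
  rw [dist_eq_norm, add_sub_cancel_left, norm_smul, norm_dirU, mul_one, Real.norm_eq_abs,
    abs_of_nonneg hs]

theorem hasDerivAt_radial_flux (hB : ContDiffOn ℝ 2 B (Metric.ball x r))
    (hrad : ∀ y z : E2, dist y x = dist z x → B y = B z) {s : ℝ} (hs : s ∈ Set.Ioo 0 r) :
    HasDerivAt (fun s => s * fderiv ℝ B (x + s • dirU 0) (dirU 0))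
      (-(s * lapl B (x + s • dirU 0))) s := by
  have hmem : ∀ θ, x + s • dirU θ ∈ Metric.ball x r := fun θ => by
    rw [Metric.mem_ball, dist_add_smul_dirU x hs.1.le]
    exact hs.2
  have hBa : ∀ θ, ContDiffAt ℝ 2 B (x + s • dirU θ) := fun θ =>
    hB.contDiffAt (Metric.isOpen_ball.mem_nhds (hmem θ))
  have hd1 : ∀ θ, DifferentiableAt ℝ B (x + s • dirU θ) := fun θ =>
    (hBa θ).differentiableAt (by norm_num)
  have hd2 : ∀ θ, DifferentiableAt ℝ (fderiv ℝ B) (x + s • dirU θ) := fun θ =>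
    ((hBa θ).fderiv_right (m := 1) (by norm_num)).differentiableAt (by norm_num)
  have hV : ∀ θ, fderiv ℝ B (x + s • dirU θ) (dirV θ) = 0 := by
    intro θ
    have hconst : (fun θ => B (x + s • dirU θ)) = fun _ => B (x + s • dirU 0) := by
      funext θ
      exact hrad _ _ (by rw [dist_add_smul_dirU x hs.1.le, dist_add_smul_dirU x hs.1.le])
    have h := hasDerivAt_angular (hd1 θ)
    rw [hconst] at h
    exact (mul_eq_zero.1 (h.unique (hasDerivAt_const θ _))).resolve_left hs.1.ne'
  have hVV : s * fderiv ℝ (fderiv ℝ B) (x + s • dirU 0) (dirV 0) (dirV 0)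
      - fderiv ℝ B (x + s • dirU 0) (dirU 0) = 0 := by
    have h := hasDerivAt_fderiv_angular (hd2 0)
    rw [funext hV] at h
    exact h.unique (hasDerivAt_const 0 _)
  refine ((hasDerivAt_id s).mul (hasDerivAt_fderiv_radial (hd2 0))).congr_deriv ?_
  have hl := fderiv_fderiv_dirU_add_dirV B (x + s • dirU 0) 0
  simp only [id]
  linear_combination s * hl - hVV

theorem continuousOn_radial (hB : ContDiffOn ℝ 2 B (Metric.ball x r)) :
    ContinuousOn (fun s => B (x + s • dirU 0)) (Set.Ico 0 r) := by
  have hc : Continuous fun s : ℝ => x + s • dirU 0 := by fun_prop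
  refine hB.continuousOn.comp hc.continuousOn fun s hs => ?_
  rw [Metric.mem_ball, dist_add_smul_dirU x hs.1]
  exact hs.2

theorem continuousOn_radial_flux (hB : ContDiffOn ℝ 2 B (Metric.ball x r)) :
    ContinuousOn (fun s => s * fderiv ℝ B (x + s • dirU 0) (dirU 0)) (Set.Ico 0 r) := by
  have hc : Continuous fun s : ℝ => x + s • dirU 0 := by fun_prop
  have h1 : ContinuousOn (fderiv ℝ B) (Metric.ball x r) :=
    hB.continuousOn_fderiv_of_isOpen Metric.isOpen_ball (by norm_num)
  have h2 : ContinuousOn (fun s : ℝ => fderiv ℝ B (x + s • dirU 0)) (Set.Ico 0 r) := by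
    refine h1.comp hc.continuousOn fun s hs => ?_
    rw [Metric.mem_ball, dist_add_smul_dirU x hs.1]
    exact hs.2
  exact continuousOn_id.mul (h2.clm_apply continuousOn_const)

theorem hasDerivAt_radial_profile (hB : ContDiffOn ℝ 2 B (Metric.ball x r)) {s : ℝ}
    (hs : s ∈ Set.Ioo 0 r) :
    HasDerivAt (fun s => B (x + s • dirU 0)) (fderiv ℝ B (x + s • dirU 0) (dirU 0)) s := by
  refine hasDerivAt_radial ((hB.contDiffAt (Metric.isOpen_ball.mem_nhds ?_)).differentiableAt
    (by norm_num))
  rw [Metric.mem_ball, dist_add_smul_dirU x hs.1.le]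
  exact hs.2

/-- A radial function with nonnegative `lapl` is radially nonincreasing. -/
theorem radial_antitone (hB : ContDiffOn ℝ 2 B (Metric.ball x r))
    (hrad : ∀ y z : E2, dist y x = dist z x → B y = B z)
    (hl : ∀ y ∈ Metric.ball x r, 0 ≤ lapl B y) {y z : E2} (hz : z ∈ Metric.ball x r)
    (hyz : dist y x ≤ dist z x) : B z ≤ B y := by
  have hsub : ∀ {s t : ℝ}, 0 ≤ s → t < r → Set.Icc s t ⊆ Set.Ico 0 r := fun hs ht u hu =>
    ⟨hs.trans hu.1, hu.2.trans_lt ht⟩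
  have hflux : ∀ s ∈ Set.Ioo 0 r, fderiv ℝ B (x + s • dirU 0) (dirU 0) ≤ 0 := by
    intro s hs
    have h := le_of_hasDerivAt_nonneg hs.1.le
      ((continuousOn_radial_flux hB).neg.mono (hsub le_rfl hs.2))
      (fun t ht => (hasDerivAt_radial_flux hB hrad ⟨ht.1, ht.2.trans hs.2⟩).neg) ?_
    · simp only [Pi.neg_apply, zero_mul, neg_zero] at h
      have h1 : s * fderiv ℝ B (x + s • dirU 0) (dirU 0) ≤ s * 0 := by linarith
      exact le_of_mul_le_mul_left h1 hs.1
    · intro t ht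
      rw [neg_neg]
      refine mul_nonneg ht.1.le (hl _ ?_)
      rw [Metric.mem_ball, dist_add_smul_dirU x ht.1.le]
      exact ht.2.trans hs.2
  have h := le_of_hasDerivAt_nonneg hyz
    ((continuousOn_radial hB).neg.mono (hsub dist_nonneg hz))
    (fun t ht => (hasDerivAt_radial_profile hB
      ⟨dist_nonneg.trans_lt ht.1, ht.2.trans hz⟩).neg)
    (fun t ht => neg_nonneg.2 (hflux t ⟨dist_nonneg.trans_lt ht.1, ht.2.trans hz⟩))
  simp only [Pi.neg_apply] at h
  rw [hrad z (x + dist z x • dirU 0) (dist_add_smul_dirU x dist_nonneg 0).symm,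
    hrad y (x + dist y x • dirU 0) (dist_add_smul_dirU x dist_nonneg 0).symm]
  linarith

end Radial

/-- Pointwise expansion of a single radial bubble, uniform in all parameters. -/
theorem radial_bubble_expansion {δ : ℝ} (hδ0 : 0 < δ) (hδ1 : δ < 1) :
    ∃ C > 0, ∃ ε₀ > 0, ∀ (B : E2 → ℝ) (x : E2) (r γ μ A L : ℝ), 0 < γ → (γ ^ 2)⁻¹ < ε₀ →
      0 < μ → 0 < L → 0 ≤ A → (μ⁻¹) ^ 2 = L / 4 * γ ^ 2 * Real.exp (γ ^ 2) →
      Real.log (1 + r ^ 2 / μ ^ 2) = δ * γ ^ 2 →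
      4 * A * γ ^ 4 * Real.exp (-((1 - δ) * γ ^ 2)) ≤ L →
      ContDiffOn ℝ 2 B (Metric.ball x r) →
      (∀ y z : E2, dist y x = dist z x → B y = B z) →
      (∀ y ∈ Metric.ball x r, lapl B y = B y * (A + L * Real.exp ((B y) ^ 2))) → B x = γ →
      ∀ z ∈ Metric.ball x r,
        |γ * (γ - B z) - T0 (dist z x / μ) + (γ ^ 2)⁻¹ * S0 (dist z x / μ)| ≤
          C * ((γ ^ 2)⁻¹) ^ 2 * (1 + T0 (dist z x / μ)) := by
  obtain ⟨C, hC, ε₀, hε₀, H⟩ := profile_expansion hδ0 hδ1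
  refine ⟨C, hC, ε₀, hε₀, ?_⟩
  intro B x r γ μ A L hγ hε hμ hL hA hμL hr hAL hB hrad hpde hBx z hz
  have hγ2 : 0 < γ ^ 2 := by positivity
  have hmul : μ ^ 2 * L * γ ^ 2 * Real.exp (γ ^ 2) = 4 := by
    have h1 : μ ^ 2 * (μ⁻¹) ^ 2 = 1 := by field_simp
    rw [hμL] at h1
    linarith
  have hscale : ∀ {s : ℝ}, s ∈ Set.Ioo 0 (r / μ) → μ * s ∈ Set.Ioo 0 r := fun {s} hs =>
    ⟨mul_pos hμ hs.1, by have := (lt_div_iff₀ hμ).1 hs.2; linarith⟩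
  have hscale' : Set.MapsTo (fun s : ℝ => μ * s) (Set.Ico 0 (r / μ)) (Set.Ico 0 r) := fun s hs =>
    ⟨mul_nonneg hμ.le hs.1, by have := (lt_div_iff₀ hμ).1 hs.2; linarith⟩
  have hlin : ∀ s : ℝ, HasDerivAt (fun s : ℝ => μ * s) μ s := fun s => by
    simpa using (hasDerivAt_id s).const_mul μ
  have hmem : ∀ {s : ℝ}, s ∈ Set.Ioo 0 r → x + s • dirU 0 ∈ Metric.ball x r := fun {s} hs => by
    rw [Metric.mem_ball, dist_add_smul_dirU x hs.1.le]
    exact hs.2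
  have hR2 : (r / μ) ^ 2 = r ^ 2 / μ ^ 2 := div_pow _ _ _
  have key := H (γ ^ 2)⁻¹ (inv_pos.2 hγ2) hε (r / μ) (μ ^ 2 * A * γ ^ 2)
    (fun s => γ * (γ - B (x + (μ * s) • dirU 0)))
    (fun s => -(γ * μ) * fderiv ℝ B (x + (μ * s) • dirU 0) (dirU 0)) ?_ (by positivity) ?_ ?_ ?_
    ?_ ?_ ?_ (dist z x / μ) ⟨by positivity, (div_lt_div_iff_of_pos_right hμ).2 hz⟩
  · simp only [mul_div_cancel₀ _ hμ.ne'] at key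
    rwa [← hrad z (x + dist z x • dirU 0) (dist_add_smul_dirU x dist_nonneg 0).symm] at key
  · rw [T0, hR2, hr]
    exact le_of_eq (by field_simp)
  · have h1 : 1 + (r / μ) ^ 2 = Real.exp (δ * γ ^ 2) := by
      rw [← hr, hR2, Real.exp_log (by positivity)]
    have h2 : Real.exp (-((1 - δ) * γ ^ 2)) * Real.exp (γ ^ 2) = Real.exp (δ * γ ^ 2) := by
      rw [← Real.exp_add]
      congr 1
      ring
    rw [h1, ← h2]
    have h3 := mul_le_mul_of_nonneg_left hAL
      (show 0 ≤ μ ^ 2 * γ ^ 2 * Real.exp (γ ^ 2) by positivity)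
    have h4 : μ ^ 2 * γ ^ 2 * Real.exp (γ ^ 2) * L = 4 := by linarith
    rw [h4] at h3
    have h5 : μ ^ 2 * A * γ ^ 2 * (Real.exp (-((1 - δ) * γ ^ 2)) * Real.exp (γ ^ 2)) * γ ^ 4
        ≤ 1 := by linarith
    rw [inv_pow, ← pow_mul, ← one_div, le_div_iff₀ (by positivity)]
    exact h5
  · exact continuousOn_const.mul (continuousOn_const.sub
      ((continuousOn_radial hB).comp (continuous_const_mul μ).continuousOn hscale'))
  · simp [hBx]
  · intro s hs
    have h := (hasDerivAt_radial_profile hB (hscale hs)).comp s (hlin s)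
    refine ((h.const_sub γ).const_mul γ).congr_deriv ?_
    ring
  · have h := (continuousOn_const (c := -γ)).mul
      ((continuousOn_radial_flux hB).comp (continuous_const_mul μ).continuousOn hscale')
    refine h.congr fun s _ => ?_
    simp only [Pi.mul_apply, Function.comp]
    ring
  · intro s hs
    have h := ((hasDerivAt_radial_flux hB hrad (hscale hs)).comp s (hlin s)).const_mul (-γ)
    refine (h.congr_of_eventuallyEq (Filter.Eventually.of_forall fun t => ?_)).congr_deriv ?_
    · simp only [Function.comp]
      ring
    · rw [hpde _ (hmem (hscale hs))]
      set b := B (x + (μ * s) • dirU 0)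
      have h1 : 1 - (γ ^ 2)⁻¹ * (γ * (γ - b)) = b / γ := by
        field_simp
        ring
      have h2 : -2 * (γ * (γ - b)) + (γ ^ 2)⁻¹ * (γ * (γ - b)) ^ 2 = b ^ 2 - γ ^ 2 := by
        field_simp
        ring
      rw [h1, h2, Real.exp_sub]
      have h3 : 4 * (b / γ) * (Real.exp (b ^ 2) / Real.exp (γ ^ 2)) =
          μ ^ 2 * L * γ * b * Real.exp (b ^ 2) := by
        rw [← hmul]
        field_simp
      rw [h3]
      field_simp
      ring

/-- Expansion of the radial bubble: for `z ∈ B_{x_α}(r_{α,δ})`,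
`B_α(z) = γ_α − t_α(z)/γ_α + S_α(z)/γ_α³ + O((1+t_α(z))/γ_α⁵)`; in particular `B_α` is
radially decreasing in `B_{x_α}(r_{α,δ})`. -/
theorem bubble_expansion
    (Ω : Set E2) (hΩo : IsOpen Ω) (hΩb : IsBounded Ω) (hΩc : IsConnected Ω)
    (lam1 : ℝ) (hlam1 : 0 < lam1)
    (v : ℕ → E2 → ℝ) (A L : ℕ → ℝ) (x : ℕ → E2)
    (hA : ∀ n, 0 ≤ A n ∧ A n < lam1) (hLpos : ∀ n, 0 < L n)
    (hsm : ∀ n, ContDiffOn ℝ (⊤ : ℕ∞) (v n) Ω)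
    (hct : ∀ n, ContinuousOn (v n) (closure Ω))
    (hpos : ∀ n, ∀ y ∈ Ω, 0 < v n y)
    (hpde : ∀ n, ∀ y ∈ Ω, lapl (v n) y = v n y * (A n + L n * Real.exp ((v n y) ^ 2)))
    (hbd : ∀ n, ∀ y ∈ frontier Ω, v n y = 0)
    (hgint : ∀ n, IntegrableOn (fun y => ‖gradient (v n) y‖ ^ 2) Ω)
    (henergy : Tendsto (fun n => ∫ y in Ω, ‖gradient (v n) y‖ ^ 2) atTop (𝓝 (4 * Real.pi)))
    (hAlim : Tendsto A atTop (𝓝 lam1)) (hLlim : Tendsto L atTop (𝓝 0))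
    (hxΩ : ∀ n, x n ∈ Ω) (hmax : ∀ n, ∀ y ∈ Ω, v n y ≤ v n (x n))
    (hγ : Tendsto (fun n => v n (x n)) atTop atTop)
    (μ : ℕ → ℝ)
    (hμ : ∀ n, 0 < μ n ∧
      ((μ n)⁻¹) ^ 2 = L n / 4 * (v n (x n)) ^ 2 * Real.exp ((v n (x n)) ^ 2))
    (δ : ℝ) (hδ0 : 0 < δ) (hδ1 : δ < 1)
    (r : ℕ → ℝ)
    (hr : ∀ n, 0 < r n ∧ Real.log (1 + (r n) ^ 2 / (μ n) ^ 2) = δ * (v n (x n)) ^ 2)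
    (B : ℕ → E2 → ℝ)
    (hBsm : ∀ n, ContDiffOn ℝ (⊤ : ℕ∞) (B n) (Metric.ball (x n) (r n)))
    (hBrad : ∀ n, ∀ y z : E2, dist y (x n) = dist z (x n) → B n y = B n z)
    (hBpde : ∀ n, ∀ y ∈ Metric.ball (x n) (r n),
      lapl (B n) y = B n y * (A n + L n * Real.exp ((B n y) ^ 2)))
    (hBx : ∀ n, B n (x n) = v n (x n)) :
    (∃ C : ℝ, 0 < C ∧ ∀ᶠ n in atTop, ∀ z ∈ Metric.ball (x n) (r n),
      |B n z - (v n (x n)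
        - Real.log (1 + (dist z (x n)) ^ 2 / (μ n) ^ 2) / v n (x n)
        + S0 (dist z (x n) / μ n) / (v n (x n)) ^ 3)|
      ≤ C * (1 + Real.log (1 + (dist z (x n)) ^ 2 / (μ n) ^ 2)) / (v n (x n)) ^ 5) ∧
    (∀ᶠ n in atTop, ∀ y ∈ Metric.ball (x n) (r n), ∀ z ∈ Metric.ball (x n) (r n),
      dist y (x n) ≤ dist z (x n) → B n z ≤ B n y) := by
  obtain ⟨C, hC, ε₀, hε₀, H⟩ := radial_bubble_expansion hδ0 hδ1
  have hsm2 : ∀ n, ContDiffOn ℝ 2 (v n) Ω := fun n => (hsm n).of_le (WithTop.coe_le_coe.2 (le_top : (2 : ℕ∞) ≤ ⊤))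
  have hBsm2 : ∀ n, ContDiffOn ℝ 2 (B n) (Metric.ball (x n) (r n)) := fun n =>
    (hBsm n).of_le (WithTop.coe_le_coe.2 (le_top : (2 : ℕ∞) ≤ ⊤))
  have hκ0 : 0 < (1 - δ) / 2 := by linarith
  have hLow := eventually_exp_le hΩo hΩb hlam1 hA hLpos hsm2 hct hpos hpde hbd hgint henergy
    hxΩ hmax hγ hκ0 (by linarith)
  have hγ2 : Tendsto (fun n => (v n (x n)) ^ 2) atTop atTop :=
    (tendsto_pow_atTop two_ne_zero).comp hγ
  have hε : Tendsto (fun n => ((v n (x n)) ^ 2)⁻¹) atTop (𝓝 0) := tendsto_inv_atTop_zero.comp hγ2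
  have hdecay : ∀ᶠ n in atTop,
      4 * lam1 * (v n (x n)) ^ 4 * Real.exp (-((1 - δ) / 2 * (v n (x n)) ^ 2)) ≤ 1 := by
    have h1 := (Real.tendsto_pow_mul_exp_neg_atTop_nhds_zero 2).comp
      (hγ2.const_mul_atTop hκ0)
    have h2 := h1.const_mul (4 * lam1 / ((1 - δ) / 2) ^ 2)
    rw [mul_zero] at h2
    filter_upwards [h2.eventually (gt_mem_nhds one_pos)] with n hn
    refine le_of_eq_of_le ?_ hn.le
    have h3 : 1 - δ ≠ 0 := (sub_pos.2 hδ1).ne'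
    simp only [Function.comp]
    field_simp
  have hsmall : ∀ᶠ n in atTop, δ * (1 + 6 * ((v n (x n)) ^ 2)⁻¹ + C * (((v n (x n)) ^ 2)⁻¹) ^ 2)
      + C * (((v n (x n)) ^ 2)⁻¹) ^ 3 < 1 := by
    have hc : Continuous fun e : ℝ => δ * (1 + 6 * e + C * e ^ 2) + C * e ^ 3 := by fun_prop
    have h := (hc.tendsto 0).comp hε
    exact h.eventually (gt_mem_nhds (by simpa using hδ1))
  have hexp : ∀ᶠ n in atTop, ∀ z ∈ Metric.ball (x n) (r n),
      |v n (x n) * (v n (x n) - B n z) - T0 (dist z (x n) / μ n)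
        + ((v n (x n)) ^ 2)⁻¹ * S0 (dist z (x n) / μ n)| ≤
          C * (((v n (x n)) ^ 2)⁻¹) ^ 2 * (1 + T0 (dist z (x n) / μ n)) := by
    filter_upwards [hLow, hdecay, hε.eventually (gt_mem_nhds hε₀)] with n h1 h2 h3
    refine H (B n) (x n) (r n) _ (μ n) (A n) (L n) (hpos n _ (hxΩ n)) h3 (hμ n).1 (hLpos n)
      (hA n).1 (hμ n).2 (hr n).2 ?_ (hBsm2 n) (hBrad n) (hBpde n) (hBx n)
    have h4 : Real.exp (-((1 - δ) * (v n (x n)) ^ 2)) =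
        Real.exp (-((1 - δ) / 2 * (v n (x n)) ^ 2)) *
          Real.exp (-((1 - δ) / 2 * (v n (x n)) ^ 2)) := by
      rw [← Real.exp_add]
      congr 1
      ring
    have h5 : 4 * A n * (v n (x n)) ^ 4 ≤ 4 * lam1 * (v n (x n)) ^ 4 :=
      mul_le_mul_of_nonneg_right (by linarith [(hA n).2]) (by positivity)
    have h6 := mul_le_mul_of_nonneg_right h5
      (Real.exp_pos (-((1 - δ) / 2 * (v n (x n)) ^ 2))).le
    have h7 := mul_le_mul_of_nonneg_right (h6.trans h2)
      (Real.exp_pos (-((1 - δ) / 2 * (v n (x n)) ^ 2))).le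
    rw [one_mul, mul_assoc (4 * A n * (v n (x n)) ^ 4), ← h4] at h7
    exact h7.trans h1
  have hT : ∀ n (z : E2), Real.log (1 + (dist z (x n)) ^ 2 / (μ n) ^ 2) =
      T0 (dist z (x n) / μ n) := fun n z => by rw [T0, div_pow]
  refine ⟨⟨C, hC, ?_⟩, ?_⟩
  · filter_upwards [hexp] with n hn z hz
    have hγ0 : 0 < v n (x n) := hpos n _ (hxΩ n)
    have h := hn z hz
    rw [hT]
    set γ := v n (x n)
    set T := T0 (dist z (x n) / μ n)
    set S := S0 (dist z (x n) / μ n)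
    have e1 : B n z - (γ - T / γ + S / γ ^ 3) =
        -(γ * (γ - B n z) - T + (γ ^ 2)⁻¹ * S) / γ := by
      field_simp
      ring
    have e2 : C * (1 + T) / γ ^ 5 = C * ((γ ^ 2)⁻¹) ^ 2 * (1 + T) / γ := by
      field_simp
    rw [e1, e2, abs_div, abs_neg, abs_of_pos hγ0]
    exact div_le_div_of_nonneg_right h hγ0.le
  · filter_upwards [hexp, hsmall] with n hn hs y _ z hz hyz
    refine radial_antitone (hBsm2 n) (hBrad n) (fun q hq => ?_) hz hyz
    have hγ0 : 0 < v n (x n) := hpos n _ (hxΩ n)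
    have h := (abs_le.1 (hn q hq)).2
    have hd0 : 0 ≤ dist q (x n) / μ n := div_nonneg dist_nonneg (hμ n).1.le
    have hS := neg_le_of_abs_le (abs_S0_le hd0)
    have hTle : T0 (dist q (x n) / μ n) ≤ δ * (v n (x n)) ^ 2 := by
      rw [← hT, ← (hr n).2]
      refine Real.log_le_log (by positivity) ?_
      have : dist q (x n) ^ 2 ≤ r n ^ 2 := pow_le_pow_left₀ dist_nonneg (le_of_lt hq) 2
      have := div_le_div_of_nonneg_right this (sq_nonneg (μ n))
      linarith
    rw [hBpde n q hq]
    set γ := v n (x n)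
    set T := T0 (dist q (x n) / μ n)
    set S := S0 (dist q (x n) / μ n)
    set e := (γ ^ 2)⁻¹ with he
    have he0 : 0 < e := by positivity
    have heγ : e * γ ^ 2 = 1 := inv_mul_cancel₀ (by positivity)
    have hup : γ * (γ - B n q) ≤ γ ^ 2 := by
      have h1 : -(e * S) ≤ e * (6 * T) := by
        have := mul_le_mul_of_nonneg_left hS he0.le
        linarith
      have h2 : (1 + 6 * e + C * e ^ 2) * T ≤ (1 + 6 * e + C * e ^ 2) * (δ * γ ^ 2) :=
        mul_le_mul_of_nonneg_left hTle (by positivity)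
      have h3 := mul_le_mul_of_nonneg_right hs.le (sq_nonneg γ)
      have h4 : C * e ^ 3 * γ ^ 2 = C * e ^ 2 := by
        linear_combination C * e ^ 2 * heγ
      linarith
    have hB0 : 0 ≤ B n q := by
      have : 0 ≤ γ * B n q := by linarith
      exact nonneg_of_mul_nonneg_right this hγ0
    exact mul_nonneg hB0 (add_nonneg (hA n).1 (mul_nonneg (hLpos n).le (Real.exp_pos _).le))
end
end
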